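/- arXiv:1905.04279 — 8 statements merged into one kernel-verified Lean document; each statement's English description precedes it below -/
import Mathlib

section
/- Let (X, Y, Z) be a centered Gaussian random vector in ℝ³ whose components each have positive variance. Then for all positive integers m and n, E[X^{2m} Y^{2m} Z^{2n}] ≥ E[X^{2m}] · E[Y^{2m}] · E[Z^{2n}]. -/
open MeasureTheory ProbabilityTheory
open scoped NNReal

/-- The `N`-th moment of `a • G - b • H`, where `G` and `H` are independent standard Gamma variables
with shape parameters `x` and `y`. -/
def gammaDiffMoment (a b : ℝ) : ℕ → ℝ → ℝ → ℝ
  | 0, _, _ => 1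
  | N + 1, x, y =>
    a * x * gammaDiffMoment a b N (x + 1) y - b * y * gammaDiffMoment a b N x (y + 1)

namespace gammaDiffMoment

variable (a b : ℝ)

lemma succ (N : ℕ) (x y : ℝ) : gammaDiffMoment a b (N + 1) x y =
    a * x * gammaDiffMoment a b N (x + 1) y - b * y * gammaDiffMoment a b N x (y + 1) := rfl

lemma swap (N : ℕ) (x y : ℝ) :
    gammaDiffMoment a b N x y = (-1) ^ N * gammaDiffMoment b a N y x := by
  induction N generalizing x y with
  | zero => simp [gammaDiffMoment]
  | succ N ih =>
    rw [succ, succ, ih (x + 1) y, ih x (y + 1)]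
    ring

lemma add_one_left (N : ℕ) (x y : ℝ) :
    gammaDiffMoment a b (N + 1) (x + 1) y =
      gammaDiffMoment a b (N + 1) x y + a * (N + 1) * gammaDiffMoment a b N (x + 1) y := by
  induction N generalizing x y with
  | zero => simp [gammaDiffMoment]; ring
  | succ N ih =>
    rw [succ a b (N + 1) (x + 1) y, ih (x + 1) y, ih x (y + 1), succ a b (N + 1) x y,
      succ a b N (x + 1) y]
    push_cast
    ring

lemma add_one_right (N : ℕ) (x y : ℝ) :
    gammaDiffMoment a b (N + 1) x (y + 1) =
      gammaDiffMoment a b (N + 1) x y - b * (N + 1) * gammaDiffMoment a b N x (y + 1) := by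
  rw [swap a b (N + 1) x (y + 1), add_one_left, swap a b (N + 1) x y, swap a b N x (y + 1)]
  ring

lemma shape_mul_add (N : ℕ) (x y : ℝ) :
    x * gammaDiffMoment a b N (x + 1) y + y * gammaDiffMoment a b N x (y + 1) =
      (x + y + N) * gammaDiffMoment a b N x y := by
  cases N with
  | zero => simp [gammaDiffMoment]
  | succ N =>
    have h := succ a b N x y
    rw [add_one_left, add_one_right]
    push_cast
    linear_combination (-(N + 1 : ℝ)) * h

lemma hasDerivAt (N : ℕ) (x y a : ℝ) :
    HasDerivAt (fun a ↦ gammaDiffMoment a (1 - a) (N + 1) x y)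
      ((N + 1) * (x + y + N) * gammaDiffMoment a (1 - a) N x y) a := by
  induction N generalizing x y with
  | zero =>
    simp only [gammaDiffMoment]
    have h := (((hasDerivAt_id' a).mul_const x).mul_const (1 : ℝ)).sub
      ((((hasDerivAt_id' a).const_sub 1).mul_const y).mul_const (1 : ℝ))
    refine h.congr_deriv ?_
    push_cast
    ring
  | succ N ih =>
    have h := (((hasDerivAt_id' a).mul_const x).mul (ih (x + 1) y)).sub
      ((((hasDerivAt_id' a).const_sub 1).mul_const y).mul (ih x (y + 1)))
    refine h.congr_deriv ?_
    have h₁ := shape_mul_add a (1 - a) (N + 1) x y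
    have h₂ := succ a (1 - a) N x y
    push_cast at h₁ ⊢
    linear_combination h₁ - (N + 1) * (x + y + N + 1) * h₂

lemma continuous (N : ℕ) (x y : ℝ) : Continuous fun a ↦ gammaDiffMoment a (1 - a) N x y := by
  cases N with
  | zero => exact continuous_const
  | succ N => exact continuous_iff_continuousAt.2 fun a ↦ (hasDerivAt N x y a).continuousAt

lemma one_zero_nonneg (N : ℕ) {x : ℝ} (hx : 0 ≤ x) (y : ℝ) : 0 ≤ gammaDiffMoment 1 0 N x y := by
  induction N generalizing x y with
  | zero => simp [gammaDiffMoment]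
  | succ N ih =>
    rw [succ]
    simpa using mul_nonneg hx (ih (by linarith) y)

/-- At a minimum over the scale parameter the recursion in the shape has no correction term, so a
lower bound that is uniform in the scale is inherited when the shape grows by one. -/
lemma le_add_one_left {N : ℕ} {x y K : ℝ} (hx : 0 ≤ x) (hy : 0 ≤ y)
    (h : ∀ a ∈ Set.Icc (0 : ℝ) 1, K ≤ gammaDiffMoment a (1 - a) (N + 1) x y) :
    ∀ a ∈ Set.Icc (0 : ℝ) 1, K ≤ gammaDiffMoment a (1 - a) (N + 1) (x + 1) y := by
  obtain ⟨c, hc, hmin⟩ := isCompact_Icc.exists_isMinOn (Set.nonempty_Icc.2 zero_le_one)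
    (continuous (N + 1) (x + 1) y).continuousOn
  have key : 0 ≤ c * gammaDiffMoment c (1 - c) N (x + 1) y := by
    rcases hc.1.eq_or_lt with h0 | h0
    · simp [← h0]
    rcases hc.2.eq_or_lt with h1 | h1
    · subst h1
      simpa using one_zero_nonneg N (by linarith : (0 : ℝ) ≤ x + 1) y
    · have hd := (hmin.isLocalMin (Icc_mem_nhds h0 h1)).hasDerivAt_eq_zero
        (hasDerivAt N (x + 1) y c)
      have hpos : (0 : ℝ) < (N + 1) * (x + 1 + y + N) := by positivity
      simp [(mul_eq_zero.1 hd).resolve_left hpos.ne']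
  intro a ha
  refine le_trans ?_ (hmin ha)
  show K ≤ gammaDiffMoment c (1 - c) (N + 1) (x + 1) y
  rw [add_one_left]
  have := h c hc
  nlinarith [mul_nonneg (by positivity : (0 : ℝ) ≤ N + 1) key]

lemma half_add_two (N : ℕ) (x : ℝ) :
    gammaDiffMoment (1 / 2) (1 / 2) (N + 2) x x =
      (N + 1) * (2 * x + N) / 4 * gammaDiffMoment (1 / 2) (1 / 2) N x x := by
  rw [succ, add_one_left, add_one_right]
  linear_combination ((N + 1 : ℝ) / 4) * shape_mul_add (1 / 2) (1 / 2) N x x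

lemma half_odd (m : ℕ) (x : ℝ) : gammaDiffMoment (1 / 2) (1 / 2) (2 * m + 1) x x = 0 := by
  have h := swap (1 / 2) (1 / 2) (2 * m + 1) x x
  rw [Odd.neg_one_pow ⟨m, rfl⟩] at h
  linarith

end gammaDiffMoment

/-- The moment of order `2 * k` of a standard Gaussian variable. -/
def gaussianEvenMoment (k : ℕ) : ℝ := ∏ l ∈ Finset.range k, (2 * l + 1 : ℝ)

lemma gaussianEvenMoment_succ (k : ℕ) :
    gaussianEvenMoment (k + 1) = gaussianEvenMoment k * (2 * k + 1) :=
  Finset.prod_range_succ _ _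

lemma gaussianEvenMoment_pos (k : ℕ) : 0 < gaussianEvenMoment k :=
  Finset.prod_pos fun _ _ ↦ by positivity

namespace gammaDiffMoment

lemma half_half_ge (m : ℕ) (a : ℝ) :
    gaussianEvenMoment m ^ 2 / 4 ^ m ≤ gammaDiffMoment a (1 - a) (2 * m) (1 / 2) (1 / 2) := by
  have hval : ∀ m : ℕ, gammaDiffMoment (1 / 2) (1 / 2) (2 * m) (1 / 2) (1 / 2) =
      gaussianEvenMoment m ^ 2 / 4 ^ m := by
    intro m
    induction m with
    | zero => simp [gammaDiffMoment, gaussianEvenMoment]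
    | succ m ih =>
      rw [mul_add_one, half_add_two, ih, gaussianEvenMoment_succ]
      push_cast
      ring
  induction m generalizing a with
  | zero => simp [gammaDiffMoment, gaussianEvenMoment]
  | succ m ih =>
    let f (N : ℕ) (a : ℝ) : ℝ := gammaDiffMoment a (1 - a) N (1 / 2) (1 / 2)
    have hd (N : ℕ) (a : ℝ) : HasDerivAt (f (N + 1)) ((N + 1) ^ 2 * f N a) a :=
      (hasDerivAt N (1 / 2) (1 / 2) a).congr_deriv (by simp only [f]; ring)
    have hf : f (2 * m + 1) (1 / 2) = 0 := by
      simp only [f]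
      convert half_odd m (1 / 2) using 2
      norm_num
    have hmono : Monotone (f (2 * m + 1)) :=
      monotone_of_deriv_nonneg (fun a ↦ (hd _ a).differentiableAt) fun a ↦ by
        rw [(hd _ a).deriv]
        exact mul_nonneg (by positivity)
          (le_trans (by positivity) (ih a))
    have hcont : Continuous (f (2 * m + 2)) := continuous _ _ _
    have hle : f (2 * m + 2) (1 / 2) ≤ f (2 * m + 2) a := by
      rcases le_total (1 / 2) a with ha | ha
      · refine monotoneOn_of_deriv_nonneg (convex_Ici (1 / 2 : ℝ)) hcont.continuousOn
          (fun c _ ↦ (hd _ c).differentiableAt.differentiableWithinAt) (fun c hc ↦ ?_)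
          (Set.mem_Ici.2 le_rfl) ha ha
        rw [interior_Ici] at hc
        rw [(hd _ c).deriv]
        exact mul_nonneg (by positivity) (hf.ge.trans (hmono hc.le))
      · refine antitoneOn_of_deriv_nonpos (convex_Iic (1 / 2 : ℝ)) hcont.continuousOn
          (fun c _ ↦ (hd _ c).differentiableAt.differentiableWithinAt) (fun c hc ↦ ?_)
          ha (Set.mem_Iic.2 le_rfl) ha
        rw [interior_Iic] at hc
        rw [(hd _ c).deriv]
        exact mul_nonpos_of_nonneg_of_nonpos (by positivity) ((hmono hc.le).trans hf.le)
    calc gaussianEvenMoment (m + 1) ^ 2 / 4 ^ (m + 1)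
        = f (2 * m + 2) (1 / 2) := by
          rw [← hval]
          simp only [f]
          congr 1
          norm_num
      _ ≤ _ := hle

lemma even_ge {m : ℕ} (hm : 0 < m) (i j : ℕ) :
    ∀ a ∈ Set.Icc (0 : ℝ) 1, gaussianEvenMoment m ^ 2 / 4 ^ m ≤
      gammaDiffMoment a (1 - a) (2 * m) (i + 1 / 2) (j + 1 / 2) := by
  obtain ⟨N, hN⟩ : ∃ N, 2 * m = N + 1 := ⟨2 * m - 1, by omega⟩
  have hsymm (x y a : ℝ) : gammaDiffMoment a (1 - a) (2 * m) x y =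
      gammaDiffMoment (1 - a) (1 - (1 - a)) (2 * m) y x := by
    rw [swap, Even.neg_one_pow (even_two_mul m), one_mul, sub_sub_cancel]
  have hstep (x y K : ℝ) (hx : 0 ≤ x) (hy : 0 ≤ y)
      (h : ∀ a ∈ Set.Icc (0 : ℝ) 1, K ≤ gammaDiffMoment a (1 - a) (2 * m) x y) :
      ∀ a ∈ Set.Icc (0 : ℝ) 1, K ≤ gammaDiffMoment a (1 - a) (2 * m) (x + 1) y := by
    rw [hN] at h ⊢
    exact le_add_one_left hx hy h
  have hflip {a : ℝ} (ha : a ∈ Set.Icc (0 : ℝ) 1) : 1 - a ∈ Set.Icc (0 : ℝ) 1 :=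
    ⟨sub_nonneg.2 ha.2, sub_le_self _ ha.1⟩
  induction i with
  | zero =>
    induction j with
    | zero =>
      intro a _
      simpa using half_half_ge m a
    | succ j ih =>
      intro a ha
      rw [hsymm]
      have := hstep (j + 1 / 2) ((0 : ℕ) + 1 / 2) _ (by positivity) (by positivity)
        (fun c hc ↦ by rw [hsymm]; exact ih _ (hflip hc)) _ (hflip ha)
      convert this using 2
      push_cast
      ring
  | succ i ih =>
    intro a ha
    convert hstep _ _ _ (by positivity) (by positivity) ih a ha using 2
    push_cast
    ring

end gammaDiffMoment

lemma integral_pow_add_two_gaussianReal (v : ℝ≥0) (k : ℕ) :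
    ∫ x, x ^ (k + 2) ∂gaussianReal 0 v = (k + 1) * v * ∫ x, x ^ k ∂gaussianReal 0 v := by
  have hmgf (n : ℕ) : ∫ x, x ^ n ∂gaussianReal 0 v =
      iteratedDeriv n (fun t ↦ Real.exp (v * t ^ 2 / 2)) 0 := by
    have h := iteratedDeriv_mgf_zero (X := id) (μ := gaussianReal 0 v) (by simp) n
    rw [mgf_id_gaussianReal] at h
    simpa using h.symm
  set f : ℝ → ℝ := fun t ↦ Real.exp (v * t ^ 2 / 2) with hf
  have hsmooth : ContDiff ℝ ⊤ f := by fun_prop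
  have hderiv (n : ℕ) (t : ℝ) :
      HasDerivAt (iteratedDeriv n f) (iteratedDeriv (n + 1) f t) t := by
    rw [iteratedDeriv_succ]
    exact ((hsmooth.differentiable_iteratedDeriv n (by simp)) t).hasDerivAt
  have h1 (t : ℝ) : iteratedDeriv 1 f t = v * t * f t := by
    rw [iteratedDeriv_one]
    have : HasDerivAt f (Real.exp (v * t ^ 2 / 2) * (v * (2 * t) / 2)) t := by
      have := ((((hasDerivAt_id' t).pow 2).const_mul (v : ℝ)).div_const 2).exp
      simpa using this
    rw [this.deriv]
    simp only [hf]
    ring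
  have hrec (n : ℕ) : ∀ t, iteratedDeriv (n + 2) f t =
      v * t * iteratedDeriv (n + 1) f t + (n + 1) * v * iteratedDeriv n f t := by
    induction n with
    | zero =>
      intro t
      have h : HasDerivAt (iteratedDeriv 1 f) (v * f t + v * t * iteratedDeriv 1 f t) t := by
        have := ((hasDerivAt_id' t).const_mul (v : ℝ)).mul (hderiv 0 t)
        refine (this.congr_deriv (by simp)).congr_of_eventuallyEq (.of_forall fun x ↦ ?_)
        simp [h1]
      rw [iteratedDeriv_succ, h.deriv]
      simp
      ring
    | succ n ih =>
      intro t
      have h := (((hasDerivAt_id' t).const_mul (v : ℝ)).mul (hderiv (n + 1) t)).add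
        ((hderiv n t).const_mul ((n + 1) * v : ℝ))
      rw [iteratedDeriv_succ, funext ih]
      refine h.deriv.trans ?_
      dsimp only
      rw [← ih]
      push_cast
      ring
  rw [hmgf, hmgf, hrec]
  simp

lemma integral_pow_gaussianReal_of_odd (v : ℝ≥0) {k : ℕ} (hk : Odd k) :
    ∫ x, x ^ k ∂gaussianReal 0 v = 0 := by
  obtain ⟨k, rfl⟩ := hk
  induction k with
  | zero => simp
  | succ k ih =>
    rw [show 2 * (k + 1) + 1 = 2 * k + 1 + 2 by ring, integral_pow_add_two_gaussianReal, ih,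
      mul_zero]

lemma integral_pow_even_gaussianReal (v : ℝ≥0) (k : ℕ) :
    ∫ x, x ^ (2 * k) ∂gaussianReal 0 v = v ^ k * gaussianEvenMoment k := by
  induction k with
  | zero => simp [gaussianEvenMoment]
  | succ k ih =>
    rw [mul_add_one, integral_pow_add_two_gaussianReal, ih, gaussianEvenMoment_succ]
    push_cast
    ring

section IndependentGaussians

variable {Ω : Type*} [MeasurableSpace Ω] {P : Measure Ω} {S T W : Ω → ℝ} {s t w : ℝ≥0}

/-- The mixed moments of `S`, `T`, `W` are those of independent centered Gaussian variables with
variances `s`, `t`, `w`. -/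
structure HasGaussianMoments (P : Measure Ω) (S T W : Ω → ℝ) (s t w : ℝ≥0) : Prop where
  integrable (i j k : ℕ) : Integrable (fun ω ↦ S ω ^ i * T ω ^ j * W ω ^ k) P
  integral_eq (i j k : ℕ) : ∫ ω, S ω ^ i * T ω ^ j * W ω ^ k ∂P =
    (∫ x, x ^ i ∂gaussianReal 0 s) * (∫ x, x ^ j ∂gaussianReal 0 t) *
      ∫ x, x ^ k ∂gaussianReal 0 w

namespace HasGaussianMoments

lemma integrable_sq_sub_sq (h : HasGaussianMoments P S T W s t w) (N i j k : ℕ) :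
    Integrable (fun ω ↦ (S ω ^ 2 - T ω ^ 2) ^ N * (S ω ^ i * T ω ^ j * W ω ^ k)) P := by
  induction N generalizing i j with
  | zero => simpa using h.integrable i j k
  | succ N ih =>
    refine ((ih (i + 2) j).sub (ih i (j + 2))).congr (.of_forall fun ω ↦ ?_)
    simp only [Pi.sub_apply]
    ring

lemma integral_sq_sub_sq_succ (h : HasGaussianMoments P S T W s t w) (N i j k : ℕ) :
    ∫ ω, (S ω ^ 2 - T ω ^ 2) ^ (N + 1) * (S ω ^ i * T ω ^ j * W ω ^ k) ∂P =
      ∫ ω, (S ω ^ 2 - T ω ^ 2) ^ N * (S ω ^ (i + 2) * T ω ^ j * W ω ^ k) ∂P -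
        ∫ ω, (S ω ^ 2 - T ω ^ 2) ^ N * (S ω ^ i * T ω ^ (j + 2) * W ω ^ k) ∂P := by
  rw [← integral_sub (h.integrable_sq_sub_sq ..) (h.integrable_sq_sub_sq ..)]
  congr with ω
  ring

lemma integral_sq_sub_sq_eq_zero (h : HasGaussianMoments P S T W s t w) (N i j k : ℕ)
    (hodd : Odd i ∨ Odd j ∨ Odd k) :
    ∫ ω, (S ω ^ 2 - T ω ^ 2) ^ N * (S ω ^ i * T ω ^ j * W ω ^ k) ∂P = 0 := by
  induction N generalizing i j with
  | zero =>
    simp only [pow_zero, one_mul]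
    rw [h.integral_eq]
    rcases hodd with ho | ho | ho <;> simp [integral_pow_gaussianReal_of_odd _ ho]
  | succ N ih =>
    rw [h.integral_sq_sub_sq_succ, ih, ih, sub_zero] <;> simpa [Nat.odd_add, parity_simps] using hodd

lemma integral_sq_sub_sq_even (h : HasGaussianMoments P S T W s t w) (N i j k : ℕ) :
    ∫ ω, (S ω ^ 2 - T ω ^ 2) ^ N * (S ω ^ (2 * i) * T ω ^ (2 * j) * W ω ^ k) ∂P =
      8 ^ N * gammaDiffMoment (s / 4) (t / 4) N (i + 1 / 2) (j + 1 / 2) *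
        ∫ ω, S ω ^ (2 * i) * T ω ^ (2 * j) * W ω ^ k ∂P := by
  induction N generalizing i j with
  | zero => simp [gammaDiffMoment]
  | succ N ih =>
    have hi := ih (i + 1) j
    have hj := ih i (j + 1)
    rw [h.integral_eq, mul_add_one, integral_pow_add_two_gaussianReal] at hi hj
    rw [h.integral_sq_sub_sq_succ, hi, hj, h.integral_eq, gammaDiffMoment.succ]
    push_cast
    rw [show (i : ℝ) + 1 + 1 / 2 = i + 1 / 2 + 1 by ring,
      show (j : ℝ) + 1 + 1 / 2 = j + 1 / 2 + 1 by ring]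
    ring

lemma integral_sq_sub_sq_ge (h : HasGaussianMoments P S T W s t w) (hst : (s : ℝ) + t = 4)
    {m : ℕ} (hm : 0 < m) {i j k : ℕ} (hi : Even i) (hj : Even j) (hk : Even k) :
    16 ^ m * gaussianEvenMoment m ^ 2 * ∫ ω, S ω ^ i * T ω ^ j * W ω ^ k ∂P ≤
      ∫ ω, (S ω ^ 2 - T ω ^ 2) ^ (2 * m) * (S ω ^ i * T ω ^ j * W ω ^ k) ∂P := by
  obtain ⟨i, rfl⟩ := hi.two_dvd
  obtain ⟨j, rfl⟩ := hj.two_dvd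
  rw [h.integral_sq_sub_sq_even]
  refine mul_le_mul_of_nonneg_right ?_ <| integral_nonneg fun ω ↦
    mul_nonneg (mul_nonneg ((even_two_mul i).pow_nonneg _) ((even_two_mul j).pow_nonneg _))
      (hk.pow_nonneg _)
  have hs := s.coe_nonneg
  have ht := t.coe_nonneg
  have hge := gammaDiffMoment.even_ge hm i j (s / 4) ⟨by positivity, by linarith⟩
  rw [show (1 : ℝ) - s / 4 = t / 4 by linarith] at hge
  calc (16 : ℝ) ^ m * gaussianEvenMoment m ^ 2
      = 8 ^ (2 * m) * (gaussianEvenMoment m ^ 2 / 4 ^ m) := by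
        rw [pow_mul, show (8 : ℝ) ^ 2 = 16 * 4 by norm_num, mul_pow]
        field_simp
    _ ≤ _ := by gcongr

lemma integral_sq_sub_sq_mul_linear_ge (h : HasGaussianMoments P S T W s t w)
    (hst : (s : ℝ) + t = 4) {m : ℕ} (hm : 0 < m) (n : ℕ) (a b : ℝ) :
    16 ^ m * gaussianEvenMoment m ^ 2 * ∫ ω, (a * S ω + b * T ω + W ω) ^ (2 * n) ∂P ≤
      ∫ ω, (S ω ^ 2 - T ω ^ 2) ^ (2 * m) * (a * S ω + b * T ω + W ω) ^ (2 * n) ∂P := by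
  let c (l i : ℕ) : ℝ := a ^ i * b ^ (l - i) * l.choose i * (2 * n).choose l
  have hexp (ω : Ω) : (a * S ω + b * T ω + W ω) ^ (2 * n) =
      ∑ l ∈ Finset.range (2 * n + 1), ∑ i ∈ Finset.range (l + 1),
        c l i * (S ω ^ i * T ω ^ (l - i) * W ω ^ (2 * n - l)) := by
    rw [add_pow]
    refine Finset.sum_congr rfl fun l _ ↦ ?_
    rw [add_pow, Finset.sum_mul, Finset.sum_mul]
    refine Finset.sum_congr rfl fun i _ ↦ ?_
    simp only [c]
    ring
  have hintegral (N : ℕ) : ∫ ω, (S ω ^ 2 - T ω ^ 2) ^ N * (a * S ω + b * T ω + W ω) ^ (2 * n) ∂P =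
      ∑ l ∈ Finset.range (2 * n + 1), ∑ i ∈ Finset.range (l + 1), c l i *
        ∫ ω, (S ω ^ 2 - T ω ^ 2) ^ N * (S ω ^ i * T ω ^ (l - i) * W ω ^ (2 * n - l)) ∂P := by
    simp_rw [hexp, Finset.mul_sum, mul_left_comm _ (c _ _)]
    rw [integral_finsetSum _ fun l _ ↦ integrable_finsetSum _ fun i _ ↦
      (h.integrable_sq_sub_sq ..).const_mul _]
    refine Finset.sum_congr rfl fun l _ ↦ ?_
    rw [integral_finsetSum _ fun i _ ↦ (h.integrable_sq_sub_sq ..).const_mul _]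
    exact Finset.sum_congr rfl fun i _ ↦ integral_const_mul _ _
  have h0 := hintegral 0
  simp only [pow_zero, one_mul] at h0
  rw [h0, hintegral, Finset.mul_sum]
  refine Finset.sum_le_sum fun l _ ↦ ?_
  rw [Finset.mul_sum]
  refine Finset.sum_le_sum fun i _ ↦ ?_
  rw [mul_left_comm]
  by_cases hodd : Odd i ∨ Odd (l - i) ∨ Odd (2 * n - l)
  · have hz := h.integral_sq_sub_sq_eq_zero 0 _ _ _ hodd
    simp only [pow_zero, one_mul] at hz
    rw [hz, h.integral_sq_sub_sq_eq_zero _ _ _ _ hodd, mul_zero, mul_zero]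
  · simp only [not_or, Nat.not_odd_iff_even] at hodd
    obtain ⟨hi, hj, hk⟩ := hodd
    refine mul_le_mul_of_nonneg_left (h.integral_sq_sub_sq_ge hst hm hi hj hk) ?_
    have := hi.pow_nonneg a
    have := hj.pow_nonneg b
    positivity

end HasGaussianMoments

end IndependentGaussians

section GaussianVector

variable {Ω : Type*} [MeasurableSpace Ω] {P : Measure Ω}

lemma HasGaussianLaw.of_linear_combinations {X Y Z : Ω → ℝ}
    (hGauss : ∀ a b c : ℝ, ∃ v : ℝ≥0,
      Measure.map (fun ω => a * X ω + b * Y ω + c * Z ω) P = gaussianReal 0 v) :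
    HasGaussianLaw (fun ω ↦ (![X, Y, Z] · ω)) P := by
  have hmeas {U : Ω → ℝ} {v : ℝ≥0} (h : Measure.map U P = gaussianReal 0 v) : AEMeasurable U P :=
    AEMeasurable.of_map_ne_zero (h ▸ IsProbabilityMeasure.ne_zero _)
  have hX : AEMeasurable X P := by obtain ⟨v, h⟩ := hGauss 1 0 0; simpa using hmeas h
  have hY : AEMeasurable Y P := by obtain ⟨v, h⟩ := hGauss 0 1 0; simpa using hmeas h
  have hZ : AEMeasurable Z P := by obtain ⟨v, h⟩ := hGauss 0 0 1; simpa using hmeas h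
  have hXYZ : AEMeasurable (fun ω ↦ (![X, Y, Z] · ω)) P :=
    aemeasurable_pi_lambda _ fun i ↦ by fin_cases i <;> simpa
  refine ⟨isGaussian_of_map_eq_gaussianReal fun L ↦ ?_⟩
  obtain ⟨v, hv⟩ := hGauss (L (Pi.single 0 1)) (L (Pi.single 1 1)) (L (Pi.single 2 1))
  refine ⟨0, v, ?_⟩
  rw [AEMeasurable.map_map_of_aemeasurable (by fun_prop) hXYZ, ← hv]
  congr 1
  ext ω
  have hsum : (![X, Y, Z] · ω) =
      X ω • Pi.single 0 1 + Y ω • Pi.single 1 1 + Z ω • (Pi.single 2 1 : Fin 3 → ℝ) := by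
    ext i
    fin_cases i <;> simp
  rw [Function.comp_apply, hsum]
  simp only [map_add, map_smul, smul_eq_mul, mul_comm]

variable [IsProbabilityMeasure P]

lemma exists_covariance_eq_mul_variance {S Z : Ω → ℝ} (hS : MemLp S 2 P) (hZ : MemLp Z 2 P) :
    ∃ c : ℝ, cov[S, Z; P] = c * Var[S; P] := by
  by_cases h : Var[S; P] = 0
  · refine ⟨0, ?_⟩
    by_contra hne
    rw [zero_mul] at hne
    have hvar (r : ℝ) : 0 ≤ 2 * (r * cov[S, Z; P]) + Var[Z; P] := by
      have := variance_nonneg (r • S + Z) P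
      rwa [variance_add (hS.const_smul r) hZ, variance_smul, h, covariance_smul_left, mul_zero,
        zero_add] at this
    have := hvar (-(Var[Z; P] + 1) / (2 * cov[S, Z; P]))
    field_simp at this
    linarith
  · exact ⟨cov[S, Z; P] / Var[S; P], (div_mul_cancel₀ _ h).symm⟩

lemma HasGaussianMoments.of_covariance_eq_zero {S T W : Ω → ℝ} {s t w : ℝ≥0}
    (h : HasGaussianLaw (fun ω ↦ (![S, T, W] · ω)) P)
    (hS : Measure.map S P = gaussianReal 0 s) (hT : Measure.map T P = gaussianReal 0 t)
    (hW : Measure.map W P = gaussianReal 0 w)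
    (hST : cov[S, T; P] = 0) (hSW : cov[S, W; P] = 0) (hTW : cov[T, W; P] = 0) :
    HasGaussianMoments P S T W s t w := by
  have hindep : iIndepFun ![S, T, W] P := h.iIndepFun_of_covariance_eq_zero fun i j hij ↦ by
    fin_cases i <;> fin_cases j <;>
      first | exact absurd rfl hij | assumption | (rw [covariance_comm]; assumption)
  have hS' : HasGaussianLaw S P := h.eval 0
  have hT' : HasGaussianLaw T P := h.eval 1
  have hW' : HasGaussianLaw W P := h.eval 2
  have hind₁ (i j : ℕ) : IndepFun (fun ω ↦ S ω ^ i) (fun ω ↦ T ω ^ j) P :=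
    (hindep.indepFun (show (0 : Fin 3) ≠ 1 by decide)).comp (φ := (· ^ i)) (ψ := (· ^ j))
      (by fun_prop) (by fun_prop)
  have hind₂ (i j k : ℕ) : IndepFun (fun ω ↦ S ω ^ i * T ω ^ j) (fun ω ↦ W ω ^ k) P :=
    (hindep.indepFun_prodMk₀ (fun i ↦ (h.eval i).aemeasurable) 0 1 2 (by decide)
      (by decide)).comp (φ := fun p : ℝ × ℝ ↦ p.1 ^ i * p.2 ^ j) (ψ := (· ^ k))
      (by fun_prop) (by fun_prop)
  have hintegral {U : Ω → ℝ} (hU : HasGaussianLaw U P) (i : ℕ) : Integrable (fun ω ↦ U ω ^ i) P := by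
    refine ((hU.memLp (ENNReal.natCast_ne_top i)).integrable_norm_pow').mono'
      (hU.aemeasurable.pow_const i).aestronglyMeasurable (.of_forall fun ω ↦ ?_)
    simp
  have hmom {U : Ω → ℝ} (hU : HasGaussianLaw U P) {u : ℝ≥0}
      (hlaw : Measure.map U P = gaussianReal 0 u) (i : ℕ) :
      ∫ ω, U ω ^ i ∂P = ∫ x, x ^ i ∂gaussianReal 0 u := by
    rw [← hlaw, integral_map hU.aemeasurable (by fun_prop)]
  refine ⟨fun i j k ↦ (hind₂ i j k).integrable_mul ((hind₁ i j).integrable_mul (hintegral hS' i)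
    (hintegral hT' j)) (hintegral hW' k), fun i j k ↦ ?_⟩
  rw [(hind₂ i j k).integral_fun_mul_eq_mul_integral
      ((hind₁ i j).integrable_mul (hintegral hS' i) (hintegral hT' j)).aestronglyMeasurable
      (hintegral hW' k).aestronglyMeasurable,
    (hind₁ i j).integral_fun_mul_eq_mul_integral (hintegral hS' i).aestronglyMeasurable
      (hintegral hT' j).aestronglyMeasurable, hmom hS' hS, hmom hT' hT, hmom hW' hW]

lemma gaussian_product_inequality_of_variance_one {X Y Z : Ω → ℝ}
    (hGauss : ∀ a b c : ℝ, ∃ v : ℝ≥0,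
      Measure.map (fun ω => a * X ω + b * Y ω + c * Z ω) P = gaussianReal 0 v)
    (hX : Var[X; P] = 1) (hY : Var[Y; P] = 1) {m : ℕ} (hm : 0 < m) (n : ℕ) :
    (∫ ω, X ω ^ (2 * m) ∂P) * (∫ ω, Y ω ^ (2 * m) ∂P) * (∫ ω, Z ω ^ (2 * n) ∂P) ≤
      ∫ ω, X ω ^ (2 * m) * Y ω ^ (2 * m) * Z ω ^ (2 * n) ∂P := by
  have hlaw := HasGaussianLaw.of_linear_combinations hGauss
  have hX2 : MemLp X 2 P := (hlaw.eval 0).memLp_two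
  have hY2 : MemLp Y 2 P := (hlaw.eval 1).memLp_two
  have hZ2 : MemLp Z 2 P := (hlaw.eval 2).memLp_two
  obtain ⟨s, hs⟩ := hGauss 1 1 0
  obtain ⟨t, ht⟩ := hGauss 1 (-1) 0
  set S : Ω → ℝ := X + Y
  set T : Ω → ℝ := X - Y
  replace hs : Measure.map S P = gaussianReal 0 s := by
    rw [← hs]; congr 1; ext ω; simp [S]
  replace ht : Measure.map T P = gaussianReal 0 t := by
    rw [← ht]; congr 1; ext ω; simp [T]; ring
  have hS2 : MemLp S 2 P := hX2.add hY2
  have hT2 : MemLp T 2 P := hX2.sub hY2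
  have hvar {U : Ω → ℝ} (hU : MemLp U 2 P) {u : ℝ≥0} (h : Measure.map U P = gaussianReal 0 u) :
      Var[U; P] = u := by
    have := variance_id_gaussianReal (μ := 0) (v := u)
    rwa [← h, variance_map aemeasurable_id hU.aemeasurable] at this
  have hst : (s : ℝ) + t = 4 := by
    rw [← hvar hS2 hs, ← hvar hT2 ht, variance_add hX2 hY2, variance_sub hX2 hY2, hX, hY]
    ring
  have hST : cov[S, T; P] = 0 := by
    rw [covariance_add_left hX2 hY2 hT2, covariance_sub_right hX2 hX2 hY2,
      covariance_sub_right hY2 hX2 hY2, covariance_self hX2.aemeasurable,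
      covariance_self hY2.aemeasurable, covariance_comm Y X, hX, hY]
    ring
  obtain ⟨a, ha⟩ := exists_covariance_eq_mul_variance hS2 hZ2
  obtain ⟨b, hb⟩ := exists_covariance_eq_mul_variance hT2 hZ2
  set W : Ω → ℝ := Z - (a • S + b • T)
  have hSW : cov[S, W; P] = 0 := by
    rw [covariance_sub_right hS2 hZ2 ((hS2.const_smul a).add (hT2.const_smul b)),
      covariance_add_right hS2 (hS2.const_smul a) (hT2.const_smul b), covariance_smul_right,
      covariance_smul_right, covariance_self hS2.aemeasurable, hST, ha]
    ring
  have hTW : cov[T, W; P] = 0 := by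
    rw [covariance_sub_right hT2 hZ2 ((hS2.const_smul a).add (hT2.const_smul b)),
      covariance_add_right hT2 (hS2.const_smul a) (hT2.const_smul b), covariance_smul_right,
      covariance_smul_right, covariance_self hT2.aemeasurable, covariance_comm T S, hST, hb]
    ring
  obtain ⟨w, hw⟩ := hGauss (-(a + b)) (b - a) 1
  replace hw : Measure.map W P = gaussianReal 0 w := by
    rw [← hw]; congr 1; ext ω; simp [W, S, T]; ring
  have hlaw' : HasGaussianLaw (fun ω ↦ (![S, T, W] · ω)) P := by
    refine HasGaussianLaw.of_linear_combinations fun c d e ↦ ?_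
    obtain ⟨v, hv⟩ := hGauss (c + d - e * (a + b)) (c - d - e * (a - b)) e
    refine ⟨v, ?_⟩
    rw [← hv]; congr 1; ext ω; simp [W, S, T]; ring
  have hmom := HasGaussianMoments.of_covariance_eq_zero hlaw' hs ht hw hST hSW hTW
  have heven {U : Ω → ℝ} (hU : MemLp U 2 P) (hU1 : Var[U; P] = 1)
      (h : ∃ v : ℝ≥0, Measure.map U P = gaussianReal 0 v) :
      ∫ ω, U ω ^ (2 * m) ∂P = gaussianEvenMoment m := by
    obtain ⟨v, hv⟩ := h
    have h1 : (v : ℝ) = 1 := by rw [← hvar hU hv, hU1]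
    have h2 := integral_pow_even_gaussianReal v m
    rwa [← hv, integral_map hU.aemeasurable (by fun_prop), h1, one_pow, one_mul] at h2
  have hXm := heven hX2 hX (by simpa using hGauss 1 0 0)
  have hYm := heven hY2 hY (by simpa using hGauss 0 1 0)
  have key := hmom.integral_sq_sub_sq_mul_linear_ge hst hm n a b
  have hZeq (ω : Ω) : a * S ω + b * T ω + W ω = Z ω := by simp [W]
  have hprod (ω : Ω) : (S ω ^ 2 - T ω ^ 2) ^ (2 * m) =
      16 ^ m * (X ω ^ (2 * m) * Y ω ^ (2 * m)) := by
    rw [← mul_pow, show (16 : ℝ) ^ m = 4 ^ (2 * m) by rw [pow_mul]; norm_num, ← mul_pow]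
    simp only [S, T, Pi.add_apply, Pi.sub_apply]
    ring
  simp_rw [hZeq, hprod, mul_assoc ((16 : ℝ) ^ m), integral_const_mul] at key
  rw [hXm, hYm, ← sq]
  exact le_of_mul_le_mul_left key (by positivity)

end GaussianVector

/-- For a centered Gaussian random vector `(X, Y, Z)` with non-degenerate components
and positive integers `m, n`: `E[X^{2m} Y^{2m} Z^{2n}] ≥ E[X^{2m}] E[Y^{2m}] E[Z^{2n}]`. -/
theorem gaussian_product_inequality_dim3_mixed
    {Ω : Type*} [MeasurableSpace Ω] (P : Measure Ω) [IsProbabilityMeasure P]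
    (X Y Z : Ω → ℝ)
    (hGauss : ∀ a b c : ℝ, ∃ v : ℝ≥0,
      Measure.map (fun ω => a * X ω + b * Y ω + c * Z ω) P = gaussianReal 0 v)
    (hX : 0 < variance X P) (hY : 0 < variance Y P) (hZ : 0 < variance Z P)
    (m n : ℕ) (hm : 0 < m) (hn : 0 < n) :
    (∫ ω, (X ω) ^ (2 * m) * (Y ω) ^ (2 * m) * (Z ω) ^ (2 * n) ∂P)
      ≥ (∫ ω, (X ω) ^ (2 * m) ∂P) * (∫ ω, (Y ω) ^ (2 * m) ∂P)
          * (∫ ω, (Z ω) ^ (2 * n) ∂P) := by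
  have hvar {U : Ω → ℝ} (hU : 0 < Var[U; P]) : Var[fun ω ↦ (√Var[U; P])⁻¹ * U ω; P] = 1 := by
    rw [variance_const_mul, inv_pow, Real.sq_sqrt hU.le, inv_mul_cancel₀ hU.ne']
  set p := (√Var[X; P])⁻¹
  set q := (√Var[Y; P])⁻¹
  have hp0 : 0 < p := inv_pos.2 (Real.sqrt_pos.2 hX)
  have hq0 : 0 < q := inv_pos.2 (Real.sqrt_pos.2 hY)
  have key := gaussian_product_inequality_of_variance_one (P := P) (X := fun ω ↦ p * X ω)
    (Y := fun ω ↦ q * Y ω) (Z := Z)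
    (fun a b c ↦ by simpa only [mul_assoc] using hGauss (a * p) (b * q) c)
    (hvar hX) (hvar hY) hm n
  have hpull (ω : Ω) : (p * X ω) ^ (2 * m) * (q * Y ω) ^ (2 * m) * Z ω ^ (2 * n) =
      p ^ (2 * m) * q ^ (2 * m) * (X ω ^ (2 * m) * Y ω ^ (2 * m) * Z ω ^ (2 * n)) := by ring
  simp_rw [hpull, mul_pow, integral_const_mul] at key
  refine le_of_mul_le_mul_left (le_of_eq_of_le ?_ key)
    (by positivity : 0 < p ^ (2 * m) * q ^ (2 * m))
  ring
end

section
/- Let (X, Y, Z) be a centered Gaussian random vector in ℝ³ whose components each have positive variance, and suppose there exist real constants α, β, γ, not all zero, such that αX + βY + γZ = 0 almost surely. Then for all positive integers m and n, E[X^{2m} Y^{2m} Z^{2n}] > E[X^{2m}] · E[Y^{2m}] · E[Z^{2n}]. -/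
open MeasureTheory ProbabilityTheory
open scoped NNReal

open PowerSeries
open scoped Nat

/-- The power series `1 / (1 - rX)`. -/
noncomputable def geomSeries (r : ℝ) : PowerSeries ℝ := mk fun i => r ^ i

/-- The power series `(1 - rX) ^ (-(k + 1 / 2))`, with coefficients written as ratios of even
moments of the standard Gaussian. -/
noncomputable def halfSeries (k : ℕ) (r : ℝ) : PowerSeries ℝ :=
  mk fun i => ((2 * (k + i) - 1)‼ : ℕ) / (((2 * k - 1)‼ : ℕ) * 2 ^ i * i !) * r ^ i

lemma doubleFactorial_two_mul_succ_sub_one (k : ℕ) :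
    (2 * (k + 1) - 1)‼ = (2 * k + 1) * (2 * k - 1)‼ := by
  rcases k with _ | k
  · simp
  · rw [show 2 * (k + 1 + 1) - 1 = (2 * k + 1) + 2 by omega, Nat.doubleFactorial_add_two]
    rw [show 2 * (k + 1) - 1 = 2 * k + 1 by omega]
    ring

lemma geomSeries_mul (r : ℝ) : geomSeries r * (1 - C r * X) = 1 := by
  ext i
  rw [mul_sub, mul_one, ← mul_assoc, mul_comm _ (C r), mul_assoc]
  rcases i with _ | i
  · simp [geomSeries]
  · simp [geomSeries, coeff_succ_mul_X, pow_succ', coeff_one]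

lemma doubleFactorial_ne_zero (k : ℕ) : ((k‼ : ℕ) : ℝ) ≠ 0 := by
  exact_mod_cast (Nat.doubleFactorial_pos k).ne'

lemma halfSeries_succ_mul (k : ℕ) (r : ℝ) :
    halfSeries (k + 1) r * (1 - C r * X) = halfSeries k r := by
  ext i
  rw [mul_sub, mul_one, ← mul_assoc, mul_comm _ (C r), mul_assoc]
  have h0 := doubleFactorial_ne_zero (2 * k - 1)
  rcases i with _ | i
  · have h1 := doubleFactorial_ne_zero (2 * (k + 1) - 1)
    simp [halfSeries, h0, h1]
  · have e1 : k + 1 + (i + 1) = (k + 1 + i) + 1 := by ring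
    have e2 : k + (i + 1) = k + 1 + i := by ring
    have h3 := doubleFactorial_ne_zero (2 * (k + 1 + i) - 1)
    have h4 : (i ! : ℝ) ≠ 0 := by positivity
    simp only [halfSeries, map_sub, coeff_mk, coeff_C_mul, coeff_succ_mul_X, e1, e2,
      doubleFactorial_two_mul_succ_sub_one (k + 1 + i), doubleFactorial_two_mul_succ_sub_one k,
      Nat.factorial_succ]
    push_cast
    have h5 : (2 * (k:ℝ) + 1) ≠ 0 := by positivity
    field_simp
    ring

lemma halfSeries_eq (k : ℕ) (r : ℝ) : halfSeries k r = halfSeries 0 r * geomSeries r ^ k := by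
  induction k with
  | zero => simp
  | succ k ih =>
    rw [pow_succ, ← mul_assoc, ← ih, ← halfSeries_succ_mul k r, mul_assoc,
      mul_comm (1 - _), geomSeries_mul, mul_one]

lemma halfSeries_zero_sq_mul (r : ℝ) : halfSeries 0 r ^ 2 * (1 - C r * X) = 1 := by
  have ode : 2 * (1 - C r * X) * d⁄dX ℝ (halfSeries 0 r) = C r * halfSeries 0 r := by
    ext i
    rw [show 2 * (1 - C r * X) * d⁄dX ℝ (halfSeries 0 r) = C 2 * (d⁄dX ℝ (halfSeries 0 r)
      - C r * (d⁄dX ℝ (halfSeries 0 r) * X)) by rw [map_ofNat]; ring]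
    rcases i with _ | i
    · rw [coeff_C_mul, coeff_C_mul, map_sub, coeff_C_mul, coeff_zero_mul_X, coeff_derivative]
      simp [halfSeries]
    · have h4 : (i ! : ℝ) ≠ 0 := by positivity
      have e (j : ℕ) : 0 + (j + 1) = (0 + j) + 1 := by ring
      simp only [coeff_C_mul, map_sub, coeff_succ_mul_X, coeff_derivative, halfSeries, coeff_mk,
        e, doubleFactorial_two_mul_succ_sub_one, Nat.factorial_succ]
      push_cast
      field_simp
      ring
  apply derivative.ext
  · simp only [Derivation.leibniz, Derivation.leibniz_pow, map_sub, smul_eq_mul]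
    simp
    linear_combination (halfSeries 0 r) * ode
  · simp [halfSeries]

lemma subst_eq_sum_add {a : PowerSeries ℝ} (ha : HasSubst a) (f : PowerSeries ℝ) (n : ℕ) :
    f.subst a = ∑ i ∈ Finset.range n, C (coeff i f) * a ^ i
      + a ^ n * (mk fun i => coeff (i + n) f).subst a := by
  conv_lhs => rw [eq_X_pow_mul_shift_add_trunc n f]
  rw [subst_add ha, subst_mul ha, subst_pow ha, subst_X ha, subst_coe ha, add_comm]
  congr 1
  exact eval₂_trunc_eq_sum_range a (algebraMap ℝ (PowerSeries ℝ)) n f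

lemma halfSeries_mul_halfSeries (r : ℝ) :
    halfSeries 0 (1 + r) * halfSeries 0 (r - 1) =
      geomSeries r * (halfSeries 0 1).subst ((X * geomSeries r) ^ 2) := by
  set s : PowerSeries ℝ := X * geomSeries r with hs
  have hsub : HasSubst (s ^ 2) := by
    apply HasSubst.of_constantCoeff_zero'
    simp [hs]
  have hB : (halfSeries 0 1).subst (s ^ 2) ^ 2 * (1 - s ^ 2) = 1 := by
    have h := congrArg (substAlgHom (R := ℝ) hsub) (halfSeries_zero_sq_mul 1)
    rw [map_one C, one_mul, map_mul, map_pow, map_sub, map_one, substAlgHom_X] at h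
    rwa [coe_substAlgHom] at h
  have hg := geomSeries_mul r
  have h1 := halfSeries_zero_sq_mul (1 + r)
  have h2 := halfSeries_zero_sq_mul (r - 1)
  have key : (1 - C (1 + r) * X) * (1 - C (r - 1) * X)
      = (1 - C r * X) ^ 2 * (1 - s ^ 2) := by
    simp only [map_add, map_sub, map_one, hs]
    linear_combination (X ^ 2 * (geomSeries r * (1 - C r * X) + 1)) * hg
  have hu : (1 - C (1 + r) * X : PowerSeries ℝ) * (1 - C (r - 1) * X) ≠ 0 := by
    intro h
    have := congrArg constantCoeff h
    simp at this
  have hsq : (halfSeries 0 (1 + r) * halfSeries 0 (r - 1)) ^ 2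
      = (geomSeries r * (halfSeries 0 1).subst (s ^ 2)) ^ 2 := by
    apply mul_right_cancel₀ hu
    trans 1
    · linear_combination h1 + (halfSeries 0 (1 + r) ^ 2 * (1 - C (1 + r) * X)) * h2
    · rw [key]
      symm
      linear_combination (geomSeries r * (1 - C r * X) + 1) * hg +
        (geomSeries r * (1 - C r * X)) ^ 2 * hB
  have hc : constantCoeff ((halfSeries 0 1).subst (s ^ 2)) = (1:ℝ) := by
    rw [subst_eq_sum_add hsub _ 1]
    simp [hs, halfSeries]
  rcases sq_eq_sq_iff_eq_or_eq_neg.mp hsq with h | h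
  · exact h
  · have := congrArg constantCoeff h
    rw [map_neg, map_mul, map_mul, hc] at this
    norm_num [halfSeries, geomSeries] at this


/-- A polynomial `p` whose difference `p - r • derivative p` is nonnegative is nonnegative. -/
lemma Polynomial.eval_nonneg_of_sub_derivative_nonneg (p : Polynomial ℝ) (r : ℝ)
    (h : ∀ x, 0 ≤ p.eval x - r * p.derivative.eval x) (x : ℝ) : 0 ≤ p.eval x := by
  set q : Polynomial ℝ := p.comp (Polynomial.C x + Polynomial.C r * Polynomial.X) with hq
  have hd (t : ℝ) : HasDerivAt (fun t => q.eval t / Real.exp t)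
      (-(q.eval t - q.derivative.eval t) / Real.exp t) t := by
    refine ((q.hasDerivAt t).fun_div (Real.hasDerivAt_exp t) (Real.exp_pos t).ne').congr_deriv ?_
    have := (Real.exp_pos t).ne'
    field_simp
    ring
  have hanti : Antitone (fun t => q.eval t / Real.exp t) := by
    apply antitone_of_deriv_nonpos (fun t => (hd t).differentiableAt)
    intro t
    rw [(hd t).deriv]
    apply div_nonpos_of_nonpos_of_nonneg _ (Real.exp_pos t).le
    have := h (x + r * t)
    simp [hq, Polynomial.derivative_comp] at this ⊢
    linarith
  have := hanti.le_of_tendsto (Polynomial.tendsto_div_exp_atTop q) 0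
  simpa [hq] using this

/-- The coefficient of `X ^ q` in `exp(tX) f(X)`, as a polynomial in `t`. -/
noncomputable def expCoeff (f : PowerSeries ℝ) (q : ℕ) : Polynomial ℝ :=
  ∑ i ∈ Finset.range (q + 1), Polynomial.C (coeff (q - i) f / i !) * Polynomial.X ^ i

lemma derivative_expCoeff_succ (f : PowerSeries ℝ) (q : ℕ) :
    (expCoeff f (q + 1)).derivative = expCoeff f q := by
  rw [expCoeff, Finset.sum_range_succ', expCoeff, Polynomial.derivative_add,
    Polynomial.derivative_sum]
  simp only [pow_zero, mul_one, Polynomial.derivative_C, add_zero]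
  refine Finset.sum_congr rfl fun i _ => ?_
  rw [Polynomial.derivative_C_mul_X_pow, Nat.add_sub_add_right, Nat.add_sub_cancel]
  congr 2
  have h4 : (i ! : ℝ) ≠ 0 := by positivity
  rw [Nat.factorial_succ]
  push_cast
  field_simp

lemma coeff_succ_geomSeries_mul (r : ℝ) (f : PowerSeries ℝ) (n : ℕ) :
    coeff (n + 1) (geomSeries r * f) = coeff (n + 1) f + r * coeff n (geomSeries r * f) := by
  have h : geomSeries r * f = f + C r * (geomSeries r * f * X) := by
    linear_combination f * geomSeries_mul r
  conv_lhs => rw [h]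
  simp [coeff_succ_mul_X]

lemma coeff_zero_geomSeries_mul (r : ℝ) (f : PowerSeries ℝ) :
    coeff 0 (geomSeries r * f) = coeff 0 f := by
  simp [geomSeries]

lemma expCoeff_succ_geomSeries_mul (r : ℝ) (f : PowerSeries ℝ) (q : ℕ) :
    expCoeff (geomSeries r * f) (q + 1) =
      expCoeff f (q + 1) + Polynomial.C r * expCoeff (geomSeries r * f) q := by
  rw [expCoeff, Finset.sum_range_succ, expCoeff, Finset.sum_range_succ _ (q + 1), expCoeff,
    Finset.mul_sum, Nat.sub_self, coeff_zero_geomSeries_mul, add_right_comm,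
    ← Finset.sum_add_distrib]
  congr 1
  refine Finset.sum_congr rfl fun i hi => ?_
  rw [Nat.sub_add_comm (by simpa [Nat.lt_succ_iff] using hi), coeff_succ_geomSeries_mul,
    ← mul_assoc, ← Polynomial.C_mul, ← add_mul, ← Polynomial.C_add]
  congr 2
  ring

/-- The even coefficients of `exp(tX) f(X)` are nonnegative for all real `t`. -/
def EvenNonneg (f : PowerSeries ℝ) : Prop := ∀ p t, 0 ≤ (expCoeff f (2 * p)).eval t

lemma evenNonneg_one : EvenNonneg 1 := by
  intro p t
  rw [expCoeff, Finset.sum_range_succ, Finset.sum_eq_zero]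
  · simp only [Nat.sub_self, coeff_zero_one, zero_add, Polynomial.eval_mul, Polynomial.eval_C,
      Polynomial.eval_pow, Polynomial.eval_X, pow_mul]
    positivity
  · intro i hi
    have : 2 * p - i ≠ 0 := by have := Finset.mem_range.mp hi; omega
    simp [coeff_one, this]

lemma EvenNonneg.geomSeries_mul {f : PowerSeries ℝ} (hf : EvenNonneg f) (r : ℝ) :
    EvenNonneg (geomSeries r * f) := by
  intro p
  rcases p with _ | p
  · intro t
    simpa [expCoeff, geomSeries] using hf 0 t
  · refine Polynomial.eval_nonneg_of_sub_derivative_nonneg _ r fun t => ?_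
    have := hf (p + 1) t
    rw [show 2 * (p + 1) = 2 * p + 1 + 1 by ring] at this ⊢
    rw [derivative_expCoeff_succ, expCoeff_succ_geomSeries_mul]
    simpa using this

lemma EvenNonneg.geomSeries_pow_mul {f : PowerSeries ℝ} (hf : EvenNonneg f) (r : ℝ) (n : ℕ) :
    EvenNonneg (geomSeries r ^ n * f) := by
  induction n with
  | zero => simpa
  | succ n ih => rw [pow_succ', mul_assoc]; exact ih.geomSeries_mul r

lemma EvenNonneg.coeff_nonneg {f : PowerSeries ℝ} (hf : EvenNonneg f) (p : ℕ) :
    0 ≤ coeff (2 * p) f := by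
  have := hf p 0
  rw [expCoeff, Finset.sum_range_succ'] at this
  simpa [Polynomial.eval_finsetSum] using this

/-- For a moment generating series, this is the variance. -/
noncomputable def seriesVariance (f : PowerSeries ℝ) : ℝ := 2 * coeff 2 f - (coeff 1 f) ^ 2

lemma seriesVariance_geomSeries_pow_mul {f : PowerSeries ℝ} (hf : coeff 0 f = 1) (r : ℝ) (n : ℕ) :
    coeff 0 (geomSeries r ^ n * f) = 1 ∧
      seriesVariance (geomSeries r ^ n * f) = n * r ^ 2 + seriesVariance f := by
  induction n with
  | zero => simpa using hf
  | succ n ih =>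
    rw [pow_succ', mul_assoc]
    refine ⟨by rw [coeff_zero_geomSeries_mul]; exact ih.1, ?_⟩
    simp only [seriesVariance] at ih ⊢
    rw [coeff_succ_geomSeries_mul, coeff_succ_geomSeries_mul, coeff_zero_geomSeries_mul, ih.1]
    push_cast
    linear_combination ih.2

lemma lt_coeff_halfSeries_mul_halfSeries (k l m : ℕ) (hm : 0 < m) (hkl : 0 < k + l) (r : ℝ) :
    ((2 * m - 1)‼ : ℕ) ^ 2 / (2 * m)! <
      coeff (2 * m) (halfSeries k (1 + r) * halfSeries l (r - 1)) := by
  obtain ⟨m, rfl⟩ : ∃ m', m = m' + 1 := ⟨m - 1, by omega⟩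
  set K : PowerSeries ℝ := geomSeries (1 + r) ^ k * (geomSeries (r - 1) ^ l * 1) with hK
  have hsub : HasSubst ((X * geomSeries r) ^ 2) := by
    apply HasSubst.of_constantCoeff_zero'
    simp
  have hK0 (j : ℕ) : coeff 0 (geomSeries r ^ j * K) = 1 := by
    simp [hK, geomSeries]
  have hKn (j : ℕ) : EvenNonneg (geomSeries r ^ j * K) :=
    ((evenNonneg_one.geomSeries_pow_mul _ _).geomSeries_pow_mul _ _).geomSeries_pow_mul _ _
  have hKv : 0 < coeff 2 (geomSeries r ^ (2 * m + 1) * K) := by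
    have h1 := seriesVariance_geomSeries_pow_mul (f := 1) (by simp) (r - 1) l
    have h2 := seriesVariance_geomSeries_pow_mul h1.1 (1 + r) k
    have h3 := seriesVariance_geomSeries_pow_mul h2.1 r (2 * m + 1)
    have h4 : seriesVariance (1 : PowerSeries ℝ) = 0 := by simp [seriesVariance, coeff_one]
    rw [← hK, h2.2, h1.2, h4, add_zero, seriesVariance] at h3
    have h5 : 0 < ((2 * m + 1 : ℕ) : ℝ) * r ^ 2 + (k * (1 + r) ^ 2 + l * (r - 1) ^ 2) := by
      by_cases hr : r = 0
      · subst hr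
        have : (0 : ℝ) < k + l := by exact_mod_cast hkl
        simpa using this
      · positivity
    nlinarith [sq_nonneg (coeff 1 (geomSeries r ^ (2 * m + 1) * K))]
  have hexp : halfSeries k (1 + r) * halfSeries l (r - 1) =
      ∑ j ∈ Finset.range (m + 1 + 1),
        C (coeff j (halfSeries 0 1)) * (X ^ (2 * j) * (geomSeries r ^ (2 * j + 1) * K))
      + X ^ (2 * (m + 1 + 1)) * (geomSeries r ^ (2 * (m + 1 + 1) + 1) * K *
          (mk fun i => coeff (i + (m + 1 + 1)) (halfSeries 0 1)).subst
            ((X * geomSeries r) ^ 2)) := by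
    rw [halfSeries_eq k, halfSeries_eq l, show halfSeries 0 (1 + r) * geomSeries (1 + r) ^ k *
        (halfSeries 0 (r - 1) * geomSeries (r - 1) ^ l) =
        halfSeries 0 (1 + r) * halfSeries 0 (r - 1) * K by rw [hK]; ring,
      halfSeries_mul_halfSeries, subst_eq_sum_add hsub _ (m + 1 + 1), mul_add, add_mul,
      Finset.mul_sum, Finset.sum_mul]
    congr 1
    · refine Finset.sum_congr rfl fun j _ => ?_
      ring
    · ring
  have hb (j : ℕ) : 0 < coeff j (halfSeries 0 1) := by
    have : 0 < (2 * j - 1)‼ := Nat.doubleFactorial_pos _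
    simp only [halfSeries, coeff_mk, zero_add, one_pow, mul_one, mul_zero, Nat.zero_sub,
      Nat.doubleFactorial, Nat.cast_one, one_mul]
    positivity
  have hbm : coeff (m + 1) (halfSeries 0 1) =
      (((2 * (m + 1) - 1)‼ : ℕ) : ℝ) ^ 2 / (2 * (m + 1))! := by
    have h0 := doubleFactorial_ne_zero (2 * m + 1)
    rw [show 2 * (m + 1) = 2 * m + 1 + 1 by ring, Nat.factorial_eq_mul_doubleFactorial,
      show 2 * m + 1 + 1 = 2 * (m + 1) by ring, Nat.doubleFactorial_two_mul,
      show 2 * (m + 1) - 1 = 2 * m + 1 by omega]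
    have h4 : (((m + 1)! : ℕ) : ℝ) ≠ 0 := by positivity
    simp only [halfSeries, coeff_mk, zero_add, one_pow, mul_one, mul_zero, Nat.zero_sub,
      Nat.doubleFactorial, Nat.cast_one, one_mul, show 2 * (m + 1) - 1 = 2 * m + 1 by omega]
    push_cast
    field_simp
  have hcoeff (j n : ℕ) (hj : j ≤ n) :
      coeff (2 * n) (C (coeff j (halfSeries 0 1)) *
        (X ^ (2 * j) * (geomSeries r ^ (2 * j + 1) * K)))
      = coeff j (halfSeries 0 1) * coeff (2 * (n - j)) (geomSeries r ^ (2 * j + 1) * K) := by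
    rw [coeff_C_mul, coeff_X_pow_mul', if_pos (by omega), Nat.mul_sub]
  rw [hexp, map_add, map_sum, coeff_X_pow_mul', if_neg (by omega), add_zero,
    Finset.sum_range_succ, Finset.sum_range_succ, hcoeff _ _ le_rfl, hcoeff _ _ (Nat.le_succ m),
    Nat.sub_self, hK0, mul_one, hbm, show m.succ - m = 1 by omega, mul_one]
  have hsum : 0 ≤ ∑ j ∈ Finset.range m, coeff (2 * (m + 1)) (C (coeff j (halfSeries 0 1)) *
      (X ^ (2 * j) * (geomSeries r ^ (2 * j + 1) * K))) :=
    Finset.sum_nonneg fun j hj => by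
      rw [hcoeff _ _ (by have := Finset.mem_range.mp hj; omega)]
      exact mul_nonneg (hb j).le ((hKn _).coeff_nonneg _)
  have := mul_pos (hb m) hKv
  linarith

lemma sum_choose_mul_doubleFactorial_lt (k l m : ℕ) (hm : 0 < m) (hkl : 0 < k + l) (a b : ℝ)
    (hab : a + b = 1) :
    (((2 * k - 1)‼ : ℕ) * ((2 * l - 1)‼ : ℕ) * ((2 * m - 1)‼ : ℕ) ^ 2 : ℝ) <
      ∑ i ∈ Finset.range (2 * m + 1), a ^ i * (-b) ^ (2 * m - i) * ((2 * m).choose i : ℝ) *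
        (((2 * (k + i) - 1)‼ : ℕ) * ((2 * (l + (2 * m - i)) - 1)‼ : ℕ)) := by
  have h := lt_coeff_halfSeries_mul_halfSeries k l m hm hkl (a - b)
  rw [show 1 + (a - b) = 2 * a by linarith, show a - b - 1 = 2 * -b by linarith, coeff_mul,
    Finset.Nat.sum_antidiagonal_eq_sum_range_succ_mk, div_lt_iff₀ (by positivity)] at h
  have hk := doubleFactorial_ne_zero (2 * k - 1)
  have hl := doubleFactorial_ne_zero (2 * l - 1)
  have hpos : (0 : ℝ) < ((2 * k - 1)‼ : ℕ) * ((2 * l - 1)‼ : ℕ) := by positivity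
  have h' := mul_lt_mul_of_pos_left h hpos
  refine h'.trans_eq ?_
  rw [Finset.sum_mul, Finset.mul_sum]
  refine Finset.sum_congr rfl fun i hi => ?_
  have hi' : i ≤ 2 * m := by have := Finset.mem_range.mp hi; omega
  have h1 : (i ! : ℝ) ≠ 0 := by positivity
  have h2 : ((2 * m - i)! : ℝ) ≠ 0 := by positivity
  rw [Nat.cast_choose ℝ hi']
  simp only [halfSeries, coeff_mk, mul_pow]
  field_simp

lemma integral_even_pow_gaussianReal (v : ℝ≥0) (k : ℕ) :
    ∫ x, x ^ (2 * k) ∂(gaussianReal 0 v) = (v : ℝ) ^ k * ((2 * k - 1)‼ : ℕ) := by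
  rcases eq_or_ne v 0 with rfl | hv
  · rcases k with _ | k <;> simp [gaussianReal_zero_var]
  have hv0 : (0 : ℝ) < v := by positivity
  have h1 : ∫ x : ℝ, x ^ (2 * k) * Real.exp (-(2 * v : ℝ)⁻¹ * x ^ 2) =
      2 * ∫ x in Set.Ioi (0 : ℝ), x ^ ((2 * k : ℕ) : ℝ) *
        Real.exp (-(2 * v : ℝ)⁻¹ * x ^ (2 : ℝ)) := by
    rw [← integral_comp_abs
      (f := fun x => x ^ ((2 * k : ℕ) : ℝ) * Real.exp (-(2 * v : ℝ)⁻¹ * x ^ (2 : ℝ)))]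
    congr with x
    rw [Real.rpow_natCast, Real.rpow_two, sq_abs, pow_mul, pow_mul, sq_abs]
  have h2 : ((2 * v : ℝ)⁻¹) ^ (-(((2 * k : ℕ) : ℝ) + 1) / 2) =
      (2 * v : ℝ) ^ k * √(2 * v) := by
    rw [Real.inv_rpow (by positivity), ← Real.rpow_neg (by positivity), Real.sqrt_eq_rpow,
      ← Real.rpow_natCast, ← Real.rpow_add (by positivity)]
    congr 1
    push_cast
    ring
  rw [integral_gaussianReal_eq_integral_smul hv]
  have h3 (x : ℝ) : gaussianPDFReal 0 v x • x ^ (2 * k) =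
      (√(2 * Real.pi * v))⁻¹ * (x ^ (2 * k) * Real.exp (-(2 * v : ℝ)⁻¹ * x ^ 2)) := by
    rw [gaussianPDFReal, smul_eq_mul, sub_zero, neg_div, div_eq_inv_mul, neg_mul]
    ring
  simp_rw [h3]
  rw [integral_const_mul, h1, integral_rpow_mul_exp_neg_mul_rpow (by norm_num)
      (by have : (0 : ℝ) ≤ ((2 * k : ℕ) : ℝ) := by positivity
          linarith) (by positivity), h2,
    show (((2 * k : ℕ) : ℝ) + 1) / 2 = k + 1 / 2 by push_cast; ring, Real.Gamma_nat_add_half,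
    show 2 * Real.pi * v = (2 * v) * Real.pi by ring, Real.sqrt_mul (by positivity)]
  have : √(2 * v : ℝ) ≠ 0 := by positivity
  have : √Real.pi ≠ 0 := by positivity
  rw [mul_pow]
  field_simp

lemma integral_odd_pow_gaussianReal (v : ℝ≥0) {j : ℕ} (hj : Odd j) :
    ∫ x, x ^ j ∂(gaussianReal 0 v) = 0 := by
  have h := gaussianReal_map_neg (μ := 0) (v := v)
  rw [neg_zero] at h
  have h2 : ∫ x, x ^ j ∂(gaussianReal 0 v) = ∫ x, (-x) ^ j ∂(gaussianReal 0 v) := by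
    conv_lhs => rw [← h]
    rw [integral_map (by fun_prop) (by fun_prop)]
  simp_rw [hj.neg_pow, integral_neg] at h2
  linarith

section IndepGaussian

variable {Ω : Type*} [MeasurableSpace Ω] {P : Measure Ω} {U V : Ω → ℝ} {u v : ℝ≥0}

lemma aemeasurable_of_map_eq_gaussianReal (hU : P.map U = gaussianReal 0 u) : AEMeasurable U P :=
  AEMeasurable.of_map_ne_zero (by rw [hU]; exact NeZero.ne _)

lemma integral_pow_of_map_eq (hU : P.map U = gaussianReal 0 u) (i : ℕ) :
    ∫ ω, U ω ^ i ∂P = ∫ x, x ^ i ∂(gaussianReal 0 u) := by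
  rw [← hU, integral_map (aemeasurable_of_map_eq_gaussianReal hU) (by fun_prop)]

lemma integral_sq_of_map_eq (hU : P.map U = gaussianReal 0 u) : ∫ ω, U ω ^ 2 ∂P = u := by
  have h := integral_even_pow_gaussianReal u 1
  rw [← integral_pow_of_map_eq hU] at h
  simpa using h

lemma integrable_pow_of_map_eq (hU : P.map U = gaussianReal 0 u) (i : ℕ) :
    Integrable (fun ω => U ω ^ i) P := by
  have h : Integrable (fun x : ℝ => x ^ i) (gaussianReal 0 u) := by
    have h := (memLp_id_gaussianReal' (μ := 0) (v := u) i (by simp)).integrable_norm_pow'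
    rw [← integrable_norm_iff (by fun_prop)]
    simpa using h
  rw [← hU] at h
  exact h.comp_aemeasurable (aemeasurable_of_map_eq_gaussianReal hU)

lemma indepFun_pow (hUV : IndepFun U V P) (i j : ℕ) :
    IndepFun (fun ω => U ω ^ i) (fun ω => V ω ^ j) P :=
  hUV.comp (measurable_id.pow_const i) (measurable_id.pow_const j)

lemma integrable_pow_mul_pow (hUV : IndepFun U V P) (hU : P.map U = gaussianReal 0 u)
    (hV : P.map V = gaussianReal 0 v) (i j : ℕ) : Integrable (fun ω => U ω ^ i * V ω ^ j) P :=
  (indepFun_pow hUV i j).integrable_mul (integrable_pow_of_map_eq hU i)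
    (integrable_pow_of_map_eq hV j)

lemma integral_pow_mul_pow (hUV : IndepFun U V P) (hU : P.map U = gaussianReal 0 u)
    (hV : P.map V = gaussianReal 0 v) (i j : ℕ) : ∫ ω, U ω ^ i * V ω ^ j ∂P =
    (∫ x, x ^ i ∂(gaussianReal 0 u)) * ∫ x, x ^ j ∂(gaussianReal 0 v) := by
  rw [(indepFun_pow hUV i j).integral_fun_mul_eq_mul_integral
    (integrable_pow_of_map_eq hU i).aestronglyMeasurable
    (integrable_pow_of_map_eq hV j).aestronglyMeasurable,
    integral_pow_of_map_eq hU, integral_pow_of_map_eq hV]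

lemma sub_sq_pow_mul_eq_sum (x y a b : ℝ) (m i j : ℕ) :
    x ^ i * y ^ j * (a * x ^ 2 - b * y ^ 2) ^ (2 * m) =
      ∑ r ∈ Finset.range (2 * m + 1), a ^ r * (-b) ^ (2 * m - r) * ((2 * m).choose r : ℝ) *
        (x ^ (i + 2 * r) * y ^ (j + 2 * (2 * m - r))) := by
  rw [sub_eq_add_neg, ← neg_mul, add_pow, Finset.mul_sum]
  refine Finset.sum_congr rfl fun r _ => ?_
  rw [mul_pow, mul_pow, pow_add, pow_add, pow_mul x 2, pow_mul y 2]
  ring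

lemma integrable_pow_mul_sub_sq_pow (hUV : IndepFun U V P) (hU : P.map U = gaussianReal 0 u)
    (hV : P.map V = gaussianReal 0 v) (a b : ℝ) (m i j : ℕ) :
    Integrable (fun ω => U ω ^ i * V ω ^ j * (a * U ω ^ 2 - b * V ω ^ 2) ^ (2 * m)) P := by
  simp_rw [sub_sq_pow_mul_eq_sum]
  exact integrable_finsetSum _ fun r _ => (integrable_pow_mul_pow hUV hU hV _ _).const_mul _

lemma integral_pow_mul_sub_sq_pow (hUV : IndepFun U V P) (hU : P.map U = gaussianReal 0 u)
    (hV : P.map V = gaussianReal 0 v) (a b : ℝ) (m i j : ℕ) :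
    ∫ ω, U ω ^ i * V ω ^ j * (a * U ω ^ 2 - b * V ω ^ 2) ^ (2 * m) ∂P =
      ∑ r ∈ Finset.range (2 * m + 1), a ^ r * (-b) ^ (2 * m - r) * ((2 * m).choose r : ℝ) *
        ((∫ x, x ^ (i + 2 * r) ∂(gaussianReal 0 u)) *
          ∫ x, x ^ (j + 2 * (2 * m - r)) ∂(gaussianReal 0 v)) := by
  simp_rw [sub_sq_pow_mul_eq_sum]
  rw [integral_finsetSum _ fun r _ => (integrable_pow_mul_pow hUV hU hV _ _).const_mul _]
  simp_rw [integral_const_mul, integral_pow_mul_pow hUV hU hV]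

lemma integral_odd_pow_mul_sub_sq_pow (hUV : IndepFun U V P) (hU : P.map U = gaussianReal 0 u)
    (hV : P.map V = gaussianReal 0 v) (a b : ℝ) (m j : ℕ) {i : ℕ} (hi : Odd i) :
    ∫ ω, U ω ^ i * V ω ^ j * (a * U ω ^ 2 - b * V ω ^ 2) ^ (2 * m) ∂P = 0 := by
  rw [integral_pow_mul_sub_sq_pow hUV hU hV]
  refine Finset.sum_eq_zero fun r _ => ?_
  rw [integral_odd_pow_gaussianReal u (hi.add_even (even_two_mul r)), zero_mul, mul_zero]

lemma integral_even_pow_mul_sub_sq_pow (hUV : IndepFun U V P) (hU : P.map U = gaussianReal 0 u)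
    (hV : P.map V = gaussianReal 0 v) {a b : ℝ} (hab : a * u + b * v = 1) {m k l : ℕ}
    (hm : 0 < m) (hkl : 0 < k + l) :
    ∃ δ > 0, ∫ ω, U ω ^ (2 * k) * V ω ^ (2 * l) * (a * U ω ^ 2 - b * V ω ^ 2) ^ (2 * m) ∂P =
      ((2 * m - 1)‼ : ℕ) ^ 2 * ∫ ω, U ω ^ (2 * k) * V ω ^ (2 * l) ∂P + u ^ k * v ^ l * δ := by
  refine ⟨_, sub_pos.mpr (sum_choose_mul_doubleFactorial_lt k l m hm hkl _ _ hab), ?_⟩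
  rw [integral_pow_mul_sub_sq_pow hUV hU hV, integral_pow_mul_pow hUV hU hV, mul_sub,
    Finset.mul_sum]
  simp_rw [← mul_add, integral_even_pow_gaussianReal]
  rw [← sub_eq_iff_eq_add', ← sub_eq_zero]
  rw [sub_sub_sub_comm, ← Finset.sum_sub_distrib, Finset.sum_eq_zero]
  · ring
  · intro r _
    rw [← neg_mul, mul_pow, mul_pow, pow_add, pow_add]
    ring

/-- Adding a factor `(aU² - bV²) ^ (2m)` with `a Var U + b Var V = 1` multiplies the even moments
of `pU + qV` by strictly more than `((2m - 1)‼) ^ 2`. -/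
lemma doubleFactorial_sq_mul_integral_lt (hUV : IndepFun U V P) (hU : P.map U = gaussianReal 0 u)
    (hV : P.map V = gaussianReal 0 v) {a b : ℝ} (hab : a * u + b * v = 1) {p q : ℝ}
    (hpq : 0 < p ^ 2 * u + q ^ 2 * v) {m n : ℕ} (hm : 0 < m) (hn : 0 < n) :
    ((2 * m - 1)‼ : ℕ) ^ 2 * ∫ ω, (p * U ω + q * V ω) ^ (2 * n) ∂P <
      ∫ ω, (a * U ω ^ 2 - b * V ω ^ 2) ^ (2 * m) * (p * U ω + q * V ω) ^ (2 * n) ∂P := by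
  have hexp (x y : ℝ) : (p * x + q * y) ^ (2 * n) = ∑ k ∈ Finset.range (2 * n + 1),
      p ^ k * q ^ (2 * n - k) * ((2 * n).choose k : ℝ) * (x ^ k * y ^ (2 * n - k)) := by
    rw [add_pow]
    refine Finset.sum_congr rfl fun k _ => ?_
    ring
  have hexp' (x y : ℝ) : (a * x ^ 2 - b * y ^ 2) ^ (2 * m) * (p * x + q * y) ^ (2 * n) =
      ∑ k ∈ Finset.range (2 * n + 1), p ^ k * q ^ (2 * n - k) * ((2 * n).choose k : ℝ) *
        (x ^ k * y ^ (2 * n - k) * (a * x ^ 2 - b * y ^ 2) ^ (2 * m)) := by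
    rw [hexp, Finset.mul_sum]
    refine Finset.sum_congr rfl fun k _ => ?_
    ring
  simp_rw [hexp', hexp]
  rw [integral_finsetSum _ fun k _ => (integrable_pow_mul_pow hUV hU hV _ _).const_mul _,
    integral_finsetSum _ fun k _ => (integrable_pow_mul_sub_sq_pow hUV hU hV _ _ _ _ _).const_mul _,
    Finset.mul_sum, ← sub_pos, ← Finset.sum_sub_distrib]
  simp_rw [integral_const_mul]
  have hterm (k l : ℕ) (hkl : k + l = n) : ∃ δ > 0, p ^ (2 * k) * q ^ (2 * n - 2 * k) *
        ((2 * n).choose (2 * k) : ℝ) *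
        (∫ ω, U ω ^ (2 * k) * V ω ^ (2 * n - 2 * k) *
          (a * U ω ^ 2 - b * V ω ^ 2) ^ (2 * m) ∂P) -
      ((2 * m - 1)‼ : ℕ) ^ 2 * (p ^ (2 * k) * q ^ (2 * n - 2 * k) *
        ((2 * n).choose (2 * k) : ℝ) * ∫ ω, U ω ^ (2 * k) * V ω ^ (2 * n - 2 * k) ∂P) =
      (p ^ 2 * u) ^ k * (q ^ 2 * v) ^ l * δ := by
    obtain ⟨δ, hδ, h⟩ := integral_even_pow_mul_sub_sq_pow hUV hU hV hab hm
      (show 0 < k + l by omega)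
    have hc : 0 < (2 * n).choose (2 * k) := Nat.choose_pos (by omega)
    refine ⟨(2 * n).choose (2 * k) * δ, by positivity, ?_⟩
    rw [show 2 * n - 2 * k = 2 * l by omega, h, mul_pow, mul_pow]
    ring
  apply Finset.sum_pos'
  · intro k hk
    have hk' : k ≤ 2 * n := by have := Finset.mem_range.mp hk; omega
    rcases Nat.even_or_odd' k with ⟨k, rfl | rfl⟩
    · obtain ⟨δ, hδ, h⟩ := hterm k (n - k) (by omega)
      rw [h]
      positivity
    · rw [integral_odd_pow_mul_sub_sq_pow hUV hU hV _ _ _ _ (odd_two_mul_add_one k),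
        integral_pow_mul_pow hUV hU hV, integral_odd_pow_gaussianReal u (odd_two_mul_add_one k)]
      simp
  · rcases (show 0 ≤ p ^ 2 * (u : ℝ) by positivity).eq_or_lt with h0 | h0
    · obtain ⟨δ, hδ, h⟩ := hterm 0 n (by omega)
      refine ⟨2 * 0, by simp, ?_⟩
      have hq : 0 < q ^ 2 * (v : ℝ) := by linarith
      rw [h]
      positivity
    · obtain ⟨δ, hδ, h⟩ := hterm n 0 (by omega)
      refine ⟨2 * n, by simp, ?_⟩
      rw [h]
      positivity

end IndepGaussian

section JointlyGaussian

variable {Ω : Type*} [MeasurableSpace Ω] {P : Measure Ω} {U V : Ω → ℝ} {u v : ℝ≥0}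

lemma variance_of_map_eq (hU : P.map U = gaussianReal 0 u) : variance U P = u := by
  have hm := aemeasurable_of_map_eq_gaussianReal hU
  rw [← variance_id_gaussianReal (μ := 0) (v := u), ← hU, variance_map aemeasurable_id hm]
  rfl

lemma hasGaussianLaw_prodMk (h : ∀ s t : ℝ, ∃ w : ℝ≥0,
    P.map (fun ω => s * U ω + t * V ω) = gaussianReal 0 w) :
    HasGaussianLaw (fun ω => (U ω, V ω)) P := by
  have hU : AEMeasurable U P := by
    obtain ⟨w, hw⟩ := h 1 0
    simpa using aemeasurable_of_map_eq_gaussianReal hw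
  have hV : AEMeasurable V P := by
    obtain ⟨w, hw⟩ := h 0 1
    simpa using aemeasurable_of_map_eq_gaussianReal hw
  refine ⟨⟨fun L => ?_⟩⟩
  have hL : (L ∘ fun ω => (U ω, V ω)) = fun ω => L (1, 0) * U ω + L (0, 1) * V ω := by
    ext ω
    have : (U ω, V ω) = U ω • ((1 : ℝ), (0 : ℝ)) + V ω • ((0 : ℝ), (1 : ℝ)) := by simp
    rw [Function.comp_apply, this, map_add, map_smul, map_smul]
    simp [mul_comm]
  obtain ⟨w, hw⟩ := h (L (1, 0)) (L (0, 1))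
  have hmap : (P.map fun ω => (U ω, V ω)).map L = gaussianReal 0 w := by
    rw [AEMeasurable.map_map_of_aemeasurable (by fun_prop) (by fun_prop), hL, hw]
  have hvar := variance_of_map_eq (P := P.map fun ω => (U ω, V ω)) hmap
  have hmean : ∫ x, L x ∂(P.map fun ω => (U ω, V ω)) = 0 := by
    have := integral_pow_of_map_eq hmap 1
    simpa using this
  rw [hmap, hvar, hmean, Real.toNNReal_coe]

lemma indepFun_of_integral_mul_eq_zero [IsProbabilityMeasure P] (h : ∀ s t : ℝ, ∃ w : ℝ≥0,
    P.map (fun ω => s * U ω + t * V ω) = gaussianReal 0 w) (h0 : ∫ ω, U ω * V ω ∂P = 0) :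
    IndepFun U V P := by
  have hG := hasGaussianLaw_prodMk h
  have hmean : ∫ ω, U ω ∂P = 0 := by
    obtain ⟨w, hw⟩ := h 1 0
    have := integral_pow_of_map_eq hw 1
    simpa using this
  apply hG.indepFun_of_covariance_eq_zero
  rw [covariance_eq_sub hG.fst.memLp_two hG.snd.memLp_two, hmean, zero_mul, sub_zero]
  exact h0

lemma integral_pow_mul_integral_pow_lt [IsProbabilityMeasure P] {X Y Z : Ω → ℝ} {x y z : ℝ≥0}
    (hX : P.map X = gaussianReal 0 x) (hY : P.map Y = gaussianReal 0 y)
    (hZ : P.map Z = gaussianReal 0 z) (hx : 0 < x) (hy : 0 < y) (hz : 0 < z)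
    (hUV : ∀ s t : ℝ, ∃ w : ℝ≥0, P.map (fun ω => s * U ω + t * V ω) = gaussianReal 0 w)
    (h0 : ∫ ω, U ω * V ω ∂P = 0) {a b p q r : ℝ} (hr : r ^ 2 = x * y)
    (hab : a * ∫ ω, U ω ^ 2 ∂P + b * ∫ ω, V ω ^ 2 ∂P = 1)
    (hXY : ∀ᵐ ω ∂P, X ω * Y ω = r * (a * U ω ^ 2 - b * V ω ^ 2))
    (hZUV : ∀ᵐ ω ∂P, Z ω = p * U ω + q * V ω) {m n : ℕ} (hm : 0 < m) (hn : 0 < n) :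
    (∫ ω, X ω ^ (2 * m) ∂P) * (∫ ω, Y ω ^ (2 * m) ∂P) * (∫ ω, Z ω ^ (2 * n) ∂P) <
      ∫ ω, X ω ^ (2 * m) * Y ω ^ (2 * m) * Z ω ^ (2 * n) ∂P := by
  have hind := indepFun_of_integral_mul_eq_zero hUV h0
  obtain ⟨u, hU⟩ := hUV 1 0
  obtain ⟨v, hV⟩ := hUV 0 1
  simp only [one_mul, zero_mul, add_zero, zero_add] at hU hV
  rw [integral_sq_of_map_eq hU, integral_sq_of_map_eq hV] at hab
  have hpq : p ^ 2 * u + q ^ 2 * v = z := by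
    rw [← integral_sq_of_map_eq hZ, ← integral_sq_of_map_eq hU, ← integral_sq_of_map_eq hV]
    have hint := integrable_pow_mul_pow hind hU hV 1 1
    simp only [pow_one] at hint
    have hUi := (integrable_pow_of_map_eq hU 2).const_mul (p ^ 2)
    have hVi := (integrable_pow_of_map_eq hV 2).const_mul (q ^ 2)
    have hs : Integrable (fun ω => p ^ 2 * U ω ^ 2 + q ^ 2 * V ω ^ 2) P := hUi.add hVi
    calc _ = p ^ 2 * ∫ ω, U ω ^ 2 ∂P + q ^ 2 * ∫ ω, V ω ^ 2 ∂P
          + (2 * p * q) * ∫ ω, U ω * V ω ∂P := by rw [h0]; ring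
      _ = ∫ ω, (p ^ 2 * U ω ^ 2 + q ^ 2 * V ω ^ 2 + (2 * p * q) * (U ω * V ω)) ∂P := by
        rw [integral_add hs (hint.const_mul _), integral_add hUi hVi]
        simp_rw [integral_const_mul]
      _ = _ := by
        refine integral_congr_ae ?_
        filter_upwards [hZUV] with ω hω
        rw [hω]
        ring
  have key := doubleFactorial_sq_mul_integral_lt hind hU hV hab (p := p) (q := q)
    (by rw [hpq]; exact hz) hm hn
  have hZn : ∫ ω, Z ω ^ (2 * n) ∂P = ∫ ω, (p * U ω + q * V ω) ^ (2 * n) ∂P := by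
    refine integral_congr_ae ?_
    filter_upwards [hZUV] with ω hω
    rw [hω]
  have hL : ∫ ω, X ω ^ (2 * m) * Y ω ^ (2 * m) * Z ω ^ (2 * n) ∂P = (x * y : ℝ) ^ m *
      ∫ ω, (a * U ω ^ 2 - b * V ω ^ 2) ^ (2 * m) * (p * U ω + q * V ω) ^ (2 * n) ∂P := by
    rw [← integral_const_mul]
    refine integral_congr_ae ?_
    filter_upwards [hXY, hZUV] with ω h1 h2
    rw [h2, ← mul_pow, h1, mul_pow, pow_mul r, hr, mul_assoc]
  rw [hL, hZn, integral_pow_of_map_eq hX, integral_pow_of_map_eq hY,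
    integral_even_pow_gaussianReal, integral_even_pow_gaussianReal]
  refine Eq.trans_lt ?_ (mul_lt_mul_of_pos_left key (by positivity))
  rw [mul_pow]
  ring

end JointlyGaussian

/-- For a centered Gaussian random vector `(X, Y, Z)` with non-degenerate components
satisfying a nontrivial linear relation `αX + βY + γZ = 0` a.s., the strict
inequality `E[X^{2m} Y^{2m} Z^{2n}] > E[X^{2m}] E[Y^{2m}] E[Z^{2n}]` holds. -/
theorem gaussian_product_inequality_dim3_degenerate_strict
    {Ω : Type*} [MeasurableSpace Ω] (P : Measure Ω) [IsProbabilityMeasure P]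
    (X Y Z : Ω → ℝ)
    (hGauss : ∀ a b c : ℝ, ∃ v : ℝ≥0,
      Measure.map (fun ω => a * X ω + b * Y ω + c * Z ω) P = gaussianReal 0 v)
    (hX : 0 < variance X P) (hY : 0 < variance Y P) (hZ : 0 < variance Z P)
    (α β γ : ℝ) (hne : ¬ (α = 0 ∧ β = 0 ∧ γ = 0))
    (hlin : ∀ᵐ ω ∂P, α * X ω + β * Y ω + γ * Z ω = 0)
    (m n : ℕ) (hm : 0 < m) (hn : 0 < n) :
    (∫ ω, (X ω) ^ (2 * m) * (Y ω) ^ (2 * m) * (Z ω) ^ (2 * n) ∂P)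
      > (∫ ω, (X ω) ^ (2 * m) ∂P) * (∫ ω, (Y ω) ^ (2 * m) ∂P)
          * (∫ ω, (Z ω) ^ (2 * n) ∂P) := by
  obtain ⟨x, hXl⟩ := hGauss 1 0 0
  obtain ⟨y, hYl⟩ := hGauss 0 1 0
  obtain ⟨z, hZl⟩ := hGauss 0 0 1
  simp only [one_mul, zero_mul, add_zero, zero_add] at hXl hYl hZl
  have hvX := variance_of_map_eq hXl
  have hvY := variance_of_map_eq hYl
  rw [hvX] at hX
  rw [hvY] at hY
  rw [variance_of_map_eq hZl] at hZ
  have hXi := integrable_pow_of_map_eq hXl 2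
  have hYi := integrable_pow_of_map_eq hYl 2
  by_cases hγ : γ = 0
  · -- `X` and `Y` are proportional: use `X` and the part of `Z` orthogonal to it.
    subst hγ
    have hβ : β ≠ 0 := by
      rintro rfl
      have h : X =ᵐ[P] 0 := by
        filter_upwards [hlin] with ω hω
        simpa [show α ≠ 0 by simpa using hne] using hω
      rw [← hvX, variance_congr h, variance_zero] at hX
      exact hX.false
    have hYX : ∀ᵐ ω ∂P, Y ω = -α / β * X ω := by
      filter_upwards [hlin] with ω hω
      field_simp
      linarith
    have hy : (y : ℝ) = (-α / β) ^ 2 * x := by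
      rw [← hvY, ← hvX, variance_congr hYX, variance_const_mul]
    set p := (∫ ω, X ω * Z ω ∂P) / x with hp
    have hXZ : Integrable (fun ω => X ω * Z ω) P := by
      have hG := hasGaussianLaw_prodMk (P := P) (U := X) (V := Z)
        fun s t => by simpa using hGauss s 0 t
      exact hG.fst.memLp_two.integrable_mul hG.snd.memLp_two
    refine integral_pow_mul_integral_pow_lt hXl hYl hZl hX hY hZ (U := X)
      (V := fun ω => Z ω - p * X ω) ?_ ?_ (a := 1 / x) (b := 0) (p := p) (q := 1)
      (r := -α / β * x) ?_ ?_ ?_ ?_ hm hn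
    · intro s t
      obtain ⟨w, hw⟩ := hGauss (s - t * p) 0 t
      refine ⟨w, hw ▸ congrArg (Measure.map · P) ?_⟩
      ext ω
      ring
    · have h (ω : Ω) : X ω * (Z ω - p * X ω) = X ω * Z ω - p * X ω ^ 2 := by ring
      simp_rw [h]
      rw [integral_sub hXZ (hXi.const_mul _), integral_const_mul, integral_sq_of_map_eq hXl, hp]
      field_simp
      ring
    · rw [hy]
      ring
    · rw [integral_sq_of_map_eq hXl]
      field_simp
      ring
    · filter_upwards [hYX] with ω hω
      rw [hω]
      field_simp
      ring
    · exact Filter.Eventually.of_forall fun ω => by ring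
  · -- `Z` is a combination of the sum and the difference of the normalized `X` and `Y`.
    have hsx : 0 < √(x : ℝ) := Real.sqrt_pos.mpr hX
    have hsy : 0 < √(y : ℝ) := Real.sqrt_pos.mpr hY
    have hsx2 : √(x : ℝ) ^ 2 = x := Real.sq_sqrt hX.le
    have hsy2 : √(y : ℝ) ^ 2 = y := Real.sq_sqrt hY.le
    set σ := √(x : ℝ)
    set τ := √(y : ℝ)
    have hcomb (s t : ℝ) : ∃ w : ℝ≥0, P.map (fun ω => s * (X ω / σ + Y ω / τ) +
        t * (X ω / σ - Y ω / τ)) = gaussianReal 0 w := by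
      obtain ⟨w, hw⟩ := hGauss ((s + t) / σ) ((s - t) / τ) 0
      refine ⟨w, hw ▸ congrArg (Measure.map · P) ?_⟩
      ext ω
      ring
    refine integral_pow_mul_integral_pow_lt hXl hYl hZl hX hY hZ hcomb ?_
      (a := 1 / 4) (b := 1 / 4) (p := -(α * σ + β * τ) / (2 * γ))
      (q := -(α * σ - β * τ) / (2 * γ)) (r := σ * τ) ?_ ?_ ?_ ?_ hm hn
    · have h (ω : Ω) : (X ω / σ + Y ω / τ) * (X ω / σ - Y ω / τ) =
          (σ ^ 2)⁻¹ * X ω ^ 2 - (τ ^ 2)⁻¹ * Y ω ^ 2 := by ring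
      simp_rw [h]
      rw [integral_sub (hXi.const_mul _) (hYi.const_mul _), integral_const_mul,
        integral_const_mul, integral_sq_of_map_eq hXl, integral_sq_of_map_eq hYl,
        hsx2, hsy2, inv_mul_cancel₀ hX.ne',
        inv_mul_cancel₀ hY.ne', sub_self]
    · rw [mul_pow, hsx2, hsy2]
    · obtain ⟨u, hu⟩ := hcomb 1 0
      obtain ⟨v, hv⟩ := hcomb 0 1
      simp only [one_mul, zero_mul, add_zero, zero_add] at hu hv
      rw [← mul_add, ← integral_add (integrable_pow_of_map_eq hu 2)
        (integrable_pow_of_map_eq hv 2)]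
      have h (ω : Ω) : (X ω / σ + Y ω / τ) ^ 2 + (X ω / σ - Y ω / τ) ^ 2 =
          2 * (σ ^ 2)⁻¹ * X ω ^ 2 + 2 * (τ ^ 2)⁻¹ * Y ω ^ 2 := by ring
      simp_rw [h]
      rw [integral_add (hXi.const_mul _) (hYi.const_mul _), integral_const_mul,
        integral_const_mul, integral_sq_of_map_eq hXl, integral_sq_of_map_eq hYl,
        hsx2, hsy2, mul_assoc, mul_assoc,
        inv_mul_cancel₀ hX.ne', inv_mul_cancel₀ hY.ne']
      norm_num
    · refine Filter.Eventually.of_forall fun ω => ?_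
      field_simp
      ring
    · filter_upwards [hlin] with ω hω
      field_simp
      linear_combination (2 * σ * τ) * hω
end

section
/- Let (Z, W) be a centered Gaussian random vector in ℝ² whose components each have positive variance. Then for every positive integer r, E[Z^{2r} W^{2r}] ≥ E[Z^{2r}] · E[W^{2r}], and equality holds if and only if Z and W are independent. -/
open MeasureTheory ProbabilityTheory
open scoped NNReal

lemma Even.add_pow_add_sub_pow_lt {n : ℕ} (hn : Even n) (hn0 : n ≠ 0) {s t : ℝ}
    (hst : |s| < |t|) (y : ℝ) :
    (s + y) ^ n + (s - y) ^ n < (t + y) ^ n + (t - y) ^ n := by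
  have hconv : StrictConvexOn ℝ Set.univ fun u : ℝ => (u + y) ^ n + (u - y) ^ n := by
    have h := (hn.strictConvexOn_pow hn0).translate_left y |>.add
      ((hn.strictConvexOn_pow hn0).translate_left (-y))
    simpa [Function.comp_def, sub_eq_add_neg] using! h
  have ht : 0 < |t| := (abs_nonneg s).trans_lt hst
  have hmem : s ∈ openSegment ℝ (-|t|) |t| := by
    rw [openSegment_eq_Ioo (by linarith)]
    exact abs_lt.mp hst
  have h := hconv.lt_on_openSegment (Set.mem_univ _) (Set.mem_univ _) (by linarith) hmem
  have hsymm : (-t + y) ^ n + (-t - y) ^ n = (t + y) ^ n + (t - y) ^ n := by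
    rw [← hn.neg_pow (-t + y), ← hn.neg_pow (-t - y)]
    ring
  rcases abs_choice t with h' | h' <;>
    simpa [h', hsymm] using h

lemma Even.add_pow_add_sub_pow_le {n : ℕ} (hn : Even n) {s t : ℝ}
    (hst : |s| ≤ |t|) (y : ℝ) :
    (s + y) ^ n + (s - y) ^ n ≤ (t + y) ^ n + (t - y) ^ n := by
  rcases eq_or_ne n 0 with rfl | hn0
  · simp
  rcases hst.lt_or_eq with h | h
  · exact (hn.add_pow_add_sub_pow_lt hn0 h y).le
  · rcases abs_eq_abs.mp h with rfl | rfl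
    · rfl
    · rw [← hn.neg_pow (-t + y), ← hn.neg_pow (-t - y)]
      exact le_of_eq (by ring)

lemma Even.pow_sub_mul_symmetrized_nonneg {n : ℕ} (hn : Even n) (c z a y : ℝ) :
    0 ≤ (z ^ n - a ^ n) *
      ((c * z + y) ^ n + (c * z - y) ^ n - ((c * a + y) ^ n + (c * a - y) ^ n)) := by
  rcases le_total |z| |a| with h | h
  · refine mul_nonneg_of_nonpos_of_nonpos ?_ ?_
    · rw [← hn.pow_abs z, ← hn.pow_abs a]
      exact sub_nonpos.mpr (by gcongr)
    · refine sub_nonpos.mpr (hn.add_pow_add_sub_pow_le ?_ y)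
      rw [abs_mul, abs_mul]
      gcongr
  · refine mul_nonneg ?_ ?_
    · rw [← hn.pow_abs z, ← hn.pow_abs a]
      exact sub_nonneg.mpr (by gcongr)
    · refine sub_nonneg.mpr (hn.add_pow_add_sub_pow_le ?_ y)
      rw [abs_mul, abs_mul]
      gcongr

lemma Even.pow_sub_mul_symmetrized_ne_zero {n : ℕ} (hn : Even n) (hn0 : n ≠ 0)
    {c z a : ℝ} (hc : c ≠ 0) (hza : |z| ≠ |a|) (y : ℝ) :
    (z ^ n - a ^ n) *
      ((c * z + y) ^ n + (c * z - y) ^ n - ((c * a + y) ^ n + (c * a - y) ^ n)) ≠ 0 := by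
  have hc' : 0 < |c| := abs_pos.mpr hc
  refine mul_ne_zero (sub_ne_zero.mpr fun h => hza ?_) (sub_ne_zero.mpr ?_)
  · rw [← hn.pow_abs z, ← hn.pow_abs a] at h
    exact (pow_left_inj₀ (abs_nonneg _) (abs_nonneg _) hn0).mp h
  · rcases hza.lt_or_gt with h | h
    · refine (hn.add_pow_add_sub_pow_lt hn0 ?_ y).ne
      rw [abs_mul, abs_mul]
      gcongr
    · refine (hn.add_pow_add_sub_pow_lt hn0 ?_ y).ne'
      rw [abs_mul, abs_mul]
      gcongr

section Moments

variable {Ω : Type*} [MeasurableSpace Ω] {P : Measure Ω}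

lemma MeasureTheory.MemLp.integrable_pow_of_even [IsFiniteMeasure P] {X : Ω → ℝ} {n : ℕ}
    (hn : Even n) (hX : MemLp X n P) : Integrable (fun ω => X ω ^ n) P := by
  simpa [hn.pow_abs] using hX.integrable_norm_pow'

lemma MeasureTheory.MemLp.pow_two_of_forall [IsFiniteMeasure P] {X : Ω → ℝ}
    (hX : ∀ p : ℕ, MemLp X p P) (n : ℕ) : MemLp (fun ω => X ω ^ n) 2 P := by
  refine (memLp_two_iff_integrable_sq ((hX 0).1.pow n)).mpr ?_
  simpa [← pow_mul] using (hX (n * 2)).integrable_pow_of_even (even_two.mul_left n)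

lemma ProbabilityTheory.IdentDistrib.integral_mul_pow_sub_eq [IsFiniteMeasure P] {Z Y : Ω → ℝ}
    (hZ : AEMeasurable Z P) (hZY : IndepFun Z Y P)
    (hsymm : IdentDistrib Y (fun ω => -Y ω) P P) (c : ℝ) (m n : ℕ) :
    ∫ ω, Z ω ^ m * (c * Z ω - Y ω) ^ n ∂P = ∫ ω, Z ω ^ m * (c * Z ω + Y ω) ^ n ∂P := by
  have hneg : IndepFun Z (fun ω => -Y ω) P := hZY.comp measurable_id measurable_neg
  have hident := (IdentDistrib.refl hZ).prodMk hsymm hZY hneg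
  have h := (hident.comp (u := fun x : ℝ × ℝ => x.1 ^ m * (c * x.1 + x.2) ^ n)
    (by fun_prop)).integral_eq
  simpa [Function.comp_def, sub_eq_add_neg] using h.symm

/-- For independent `Z`, `Y` with `Y` symmetric, the covariance of `Z ^ n` and `(c * Z + Y) ^ n`
is half the integral of a function that is nonnegative when `n` is even. -/
lemma ProbabilityTheory.IndepFun.integral_pow_sub_mul_symmetrized [IsProbabilityMeasure P]
    {Z Y : Ω → ℝ} (hZ : ∀ p : ℕ, MemLp Z p P) (hY : ∀ p : ℕ, MemLp Y p P)
    (hZY : IndepFun Z Y P) (hsymm : IdentDistrib Y (fun ω => -Y ω) P P) (c a : ℝ) (n : ℕ)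
    (ha : a ^ n = ∫ ω, Z ω ^ n ∂P) :
    Integrable (fun ω => (Z ω ^ n - a ^ n) * ((c * Z ω + Y ω) ^ n + (c * Z ω - Y ω) ^ n
      - ((c * a + Y ω) ^ n + (c * a - Y ω) ^ n))) P ∧
    ∫ ω, (Z ω ^ n - a ^ n) * ((c * Z ω + Y ω) ^ n + (c * Z ω - Y ω) ^ n
      - ((c * a + Y ω) ^ n + (c * a - Y ω) ^ n)) ∂P
      = 2 * ((∫ ω, Z ω ^ n * (c * Z ω + Y ω) ^ n ∂P)
        - (∫ ω, Z ω ^ n ∂P) * ∫ ω, (c * Z ω + Y ω) ^ n ∂P) := by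
  have hZn := MemLp.pow_two_of_forall hZ n
  have hU := MemLp.pow_two_of_forall (fun p => ((hZ p).const_mul c).add (hY p)) n
  have hV := MemLp.pow_two_of_forall (fun p => ((hZ p).const_mul c).sub (hY p)) n
  have hA := MemLp.pow_two_of_forall (fun p => (memLp_const (c * a)).add (hY p)) n
  have hB := MemLp.pow_two_of_forall (fun p => (memLp_const (c * a)).sub (hY p)) n
  simp only [Pi.add_apply, Pi.sub_apply] at hU hV hA hB
  have hR : MemLp (fun ω => Z ω ^ n - a ^ n) 2 P := hZn.sub (memLp_const (a ^ n))
  have iU : Integrable (fun ω => Z ω ^ n * (c * Z ω + Y ω) ^ n) P := hZn.integrable_mul hU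
  have iV : Integrable (fun ω => Z ω ^ n * (c * Z ω - Y ω) ^ n) P := hZn.integrable_mul hV
  have iU' := (hU.integrable one_le_two).const_mul (a ^ n)
  have iV' := (hV.integrable one_le_two).const_mul (a ^ n)
  have iR : Integrable (fun ω => (Z ω ^ n - a ^ n) *
      ((c * a + Y ω) ^ n + (c * a - Y ω) ^ n)) P := hR.integrable_mul (hA.add hB)
  have hzero : ∫ ω, (Z ω ^ n - a ^ n) * ((c * a + Y ω) ^ n + (c * a - Y ω) ^ n) ∂P = 0 := by
    have hind : IndepFun (fun ω => Z ω ^ n - a ^ n)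
        (fun ω => (c * a + Y ω) ^ n + (c * a - Y ω) ^ n) P :=
      hZY.comp (φ := fun z => z ^ n - a ^ n)
        (ψ := fun y => (c * a + y) ^ n + (c * a - y) ^ n) (by fun_prop) (by fun_prop)
    rw [hind.integral_fun_mul_eq_mul_integral hR.1 (hA.add hB).1,
      integral_sub (hZn.integrable one_le_two) (integrable_const _), ← ha]
    simp
  have hexp : (fun ω => (Z ω ^ n - a ^ n) * ((c * Z ω + Y ω) ^ n + (c * Z ω - Y ω) ^ n
      - ((c * a + Y ω) ^ n + (c * a - Y ω) ^ n)))
      = fun ω => Z ω ^ n * (c * Z ω + Y ω) ^ n + Z ω ^ n * (c * Z ω - Y ω) ^ n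
        - a ^ n * (c * Z ω + Y ω) ^ n - a ^ n * (c * Z ω - Y ω) ^ n
        - (Z ω ^ n - a ^ n) * ((c * a + Y ω) ^ n + (c * a - Y ω) ^ n) := by
    ext ω
    ring
  have hZm : AEMeasurable Z P := (hZ 0).1.aemeasurable
  have h₁ := hsymm.integral_mul_pow_sub_eq hZm hZY c n n
  have h₂ := hsymm.integral_mul_pow_sub_eq hZm hZY c 0 n
  simp only [pow_zero, one_mul] at h₂
  rw [hexp]
  refine ⟨(((iU.add iV).sub iU').sub iV').sub iR, ?_⟩
  rw [integral_sub (by fun_prop) iR, integral_sub (by fun_prop) iV',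
    integral_sub (by fun_prop) iU', integral_add iU iV, integral_const_mul, integral_const_mul,
    hzero, h₁, h₂, ← ha]
  ring

lemma ProbabilityTheory.IndepFun.integral_pow_mul_integral_pow_le [IsProbabilityMeasure P]
    {Z Y : Ω → ℝ} (hZ : ∀ p : ℕ, MemLp Z p P) (hY : ∀ p : ℕ, MemLp Y p P)
    (hZY : IndepFun Z Y P) (hsymm : IdentDistrib Y (fun ω => -Y ω) P P) (c : ℝ) {n : ℕ}
    (hn : Even n) (hn0 : n ≠ 0) :
    (∫ ω, Z ω ^ n ∂P) * ∫ ω, (c * Z ω + Y ω) ^ n ∂P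
      ≤ ∫ ω, Z ω ^ n * (c * Z ω + Y ω) ^ n ∂P := by
  obtain ⟨a, ha⟩ : ∃ a : ℝ, a ^ n = ∫ ω, Z ω ^ n ∂P :=
    ⟨(∫ ω, Z ω ^ n ∂P) ^ (n⁻¹ : ℝ),
      Real.rpow_inv_natCast_pow (integral_nonneg fun ω => hn.pow_nonneg (Z ω)) hn0⟩
  have h := (hZY.integral_pow_sub_mul_symmetrized hZ hY hsymm c a n ha).2
  have := integral_nonneg_of_ae (μ := P)
    (ae_of_all _ fun ω => hn.pow_sub_mul_symmetrized_nonneg c (Z ω) a (Y ω))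
  linarith

lemma ProbabilityTheory.IndepFun.integral_pow_mul_integral_pow_lt [IsProbabilityMeasure P]
    {Z Y : Ω → ℝ} (hZ : ∀ p : ℕ, MemLp Z p P) (hY : ∀ p : ℕ, MemLp Y p P)
    (hZY : IndepFun Z Y P) (hsymm : IdentDistrib Y (fun ω => -Y ω) P P) {c : ℝ} (hc : c ≠ 0)
    (hatom : ∀ x, ∀ᵐ ω ∂P, Z ω ≠ x) {n : ℕ} (hn : Even n) (hn0 : n ≠ 0) :
    (∫ ω, Z ω ^ n ∂P) * ∫ ω, (c * Z ω + Y ω) ^ n ∂P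
      < ∫ ω, Z ω ^ n * (c * Z ω + Y ω) ^ n ∂P := by
  refine (hZY.integral_pow_mul_integral_pow_le hZ hY hsymm c hn hn0).lt_of_ne fun heq => ?_
  obtain ⟨a, ha⟩ : ∃ a : ℝ, a ^ n = ∫ ω, Z ω ^ n ∂P :=
    ⟨(∫ ω, Z ω ^ n ∂P) ^ (n⁻¹ : ℝ),
      Real.rpow_inv_natCast_pow (integral_nonneg fun ω => hn.pow_nonneg (Z ω)) hn0⟩
  obtain ⟨hint, h⟩ := hZY.integral_pow_sub_mul_symmetrized hZ hY hsymm c a n ha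
  rw [heq, sub_self, mul_zero, integral_eq_zero_iff_of_nonneg
    (fun ω => hn.pow_sub_mul_symmetrized_nonneg c (Z ω) a (Y ω)) hint] at h
  have hfalse : ∀ᵐ _ ∂P, False := by
    filter_upwards [h, hatom a, hatom (-a)] with ω hω h₁ h₂
    refine hn.pow_sub_mul_symmetrized_ne_zero hn0 hc (fun habs => ?_) (Y ω) hω
    exact (abs_eq_abs.mp habs).elim h₁ h₂
  simpa using hfalse.exists

end Moments

section Gaussian

variable {Ω : Type*} [MeasurableSpace Ω] {P : Measure Ω}

lemma ProbabilityTheory.hasGaussianLaw_prodMk_of_forall_map_eq [IsProbabilityMeasure P]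
    {Z W : Ω → ℝ} (hGauss : ∀ a b : ℝ, ∃ v : ℝ≥0,
      Measure.map (fun ω => a * Z ω + b * W ω) P = gaussianReal 0 v) :
    HasGaussianLaw (fun ω => (Z ω, W ω)) P := by
  have hmeas (a b : ℝ) : AEMeasurable (fun ω => a * Z ω + b * W ω) P := by
    obtain ⟨v, hv⟩ := hGauss a b
    exact aemeasurable_of_map_neZero (by rw [hv]; infer_instance)
  have hZ : AEMeasurable Z P := by simpa using hmeas 1 0
  have hW : AEMeasurable W P := by simpa using hmeas 0 1
  refine ⟨isGaussian_of_map_eq_gaussianReal fun L => ?_⟩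
  obtain ⟨v, hv⟩ := hGauss (L (1, 0)) (L (0, 1))
  refine ⟨0, v, ?_⟩
  rw [AEMeasurable.map_map_of_aemeasurable (by fun_prop) (by fun_prop), ← hv]
  congr 1
  ext ω
  have hdecomp : (Z ω, W ω) = Z ω • ((1, 0) : ℝ × ℝ) + W ω • ((0, 1) : ℝ × ℝ) := by simp
  simp only [Function.comp_apply]
  rw [hdecomp, map_add, map_smul, map_smul, smul_eq_mul, smul_eq_mul, mul_comm, mul_comm (W ω)]

lemma ProbabilityTheory.HasGaussianLaw.ae_ne {X : Ω → ℝ} (hX : HasGaussianLaw X P)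
    (hvar : 0 < variance X P) (x : ℝ) : ∀ᵐ ω ∂P, X ω ≠ x := by
  have := nullSingletonClass_gaussianReal (μ := P[X]) (v := (variance X P).toNNReal)
    (by simpa using hvar)
  have h : ∀ᵐ y ∂(P.map X), y ≠ x := by
    rw [hX.map_eq_gaussianReal]
    simp [ae_iff]
  exact ae_of_ae_map hX.aemeasurable h

lemma ProbabilityTheory.identDistrib_neg_of_map_eq_gaussianReal {X : Ω → ℝ} {v : ℝ≥0}
    (hX : P.map X = gaussianReal 0 v) : IdentDistrib X (fun ω => -X ω) P P := by
  have hm : AEMeasurable X P := aemeasurable_of_map_neZero (by rw [hX]; infer_instance)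
  refine ⟨hm, hm.neg, ?_⟩
  have h := AEMeasurable.map_map_of_aemeasurable (g := fun x : ℝ => -x) (by fun_prop) hm
  rw [hX, gaussianReal_map_neg, neg_zero] at h
  rw [hX, h]
  rfl

end Gaussian

/-- The 2-dimensional Gaussian product inequality: for a centered Gaussian random
vector `(Z, W)` with non-degenerate components and a positive integer `r`:
`E[Z^{2r} W^{2r}] ≥ E[Z^{2r}] E[W^{2r}]`, with equality iff `Z, W` are independent. -/
theorem gaussian_product_inequality_dim2
    {Ω : Type*} [MeasurableSpace Ω] (P : Measure Ω) [IsProbabilityMeasure P]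
    (Z W : Ω → ℝ)
    (hGauss : ∀ a b : ℝ, ∃ v : ℝ≥0,
      Measure.map (fun ω => a * Z ω + b * W ω) P = gaussianReal 0 v)
    (hZ : 0 < variance Z P) (hW : 0 < variance W P)
    (r : ℕ) (hr : 0 < r) :
    (∫ ω, (Z ω) ^ (2 * r) * (W ω) ^ (2 * r) ∂P)
        ≥ (∫ ω, (Z ω) ^ (2 * r) ∂P) * (∫ ω, (W ω) ^ (2 * r) ∂P)
      ∧ ((∫ ω, (Z ω) ^ (2 * r) * (W ω) ^ (2 * r) ∂P)
            = (∫ ω, (Z ω) ^ (2 * r) ∂P) * (∫ ω, (W ω) ^ (2 * r) ∂P)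
          ↔ IndepFun Z W P) := by
  have hZW : HasGaussianLaw (fun ω => (Z ω, W ω)) P :=
    hasGaussianLaw_prodMk_of_forall_map_eq hGauss
  have hn : Even (2 * r) := even_two_mul r
  have hn0 : 2 * r ≠ 0 := by omega
  set c : ℝ := cov[Z, W; P] / variance Z P with hc
  set Y : Ω → ℝ := fun ω => W ω - c * Z ω with hYdef
  have hZY : HasGaussianLaw (fun ω => (Z ω, Y ω)) P := by
    simpa [hYdef] using hZW.map_fun ((ContinuousLinearMap.fst ℝ ℝ ℝ).prod
      (ContinuousLinearMap.snd ℝ ℝ ℝ - c • ContinuousLinearMap.fst ℝ ℝ ℝ))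
  have hindep : IndepFun Z Y P := by
    refine hZY.indepFun_of_covariance_eq_zero ?_
    rw [covariance_fun_sub_right hZW.fst.memLp_two hZW.snd.memLp_two
      (hZW.fst.memLp_two.const_mul c), covariance_const_mul_right,
      covariance_self hZW.fst.aemeasurable, hc, div_mul_cancel₀ _ hZ.ne', sub_self]
  have hsymm : IdentDistrib Y (fun ω => -Y ω) P P := by
    obtain ⟨v, hv⟩ := hGauss (-c) 1
    refine identDistrib_neg_of_map_eq_gaussianReal (v := v) ?_
    rw [← hv, hYdef]
    congr 1
    ext ω
    ring
  have hZp (p : ℕ) : MemLp Z p P := hZW.fst.memLp (by simp)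
  have hYp (p : ℕ) : MemLp Y p P := hZY.snd.memLp (by simp)
  have hWeq (ω : Ω) : c * Z ω + Y ω = W ω := by simp [hYdef]
  have hle := hindep.integral_pow_mul_integral_pow_le hZp hYp hsymm c hn hn0
  simp only [hWeq] at hle
  refine ⟨hle, fun heq => ?_, fun hi => ?_⟩
  · have hc0 : c = 0 := by
      by_contra hne
      have hlt := hindep.integral_pow_mul_integral_pow_lt hZp hYp hsymm hne
        (hZW.fst.ae_ne hZ) hn hn0
      simp only [hWeq] at hlt
      exact hlt.ne' heq
    simpa [hYdef, hc0] using hindep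
  · exact (hi.comp (φ := fun x => x ^ (2 * r)) (ψ := fun x => x ^ (2 * r)) (by fun_prop)
      (by fun_prop)).integral_fun_mul_eq_mul_integral
      (hZW.fst.aemeasurable.pow_const _).aestronglyMeasurable
      (hZW.snd.aemeasurable.pow_const _).aestronglyMeasurable
end

section
/- For every positive integer r and every nonnegative integer n, the combinatorial identity ∑_{i=0}^{2r} (−1)^i · C(2r, i) · (1/2)_{n+2r−i} · (1/2)_{n+i} = 2^{2r} · (1/2)_n · (1/2)_r · (1/2)_{n+r} holds, where C(2r, i) is the ordinary binomial coefficient. -/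
/-- The rising factorial `(α)_k = α (α+1) ⋯ (α+k-1)`, with `(α)_0 = 1`. -/
def risingFactorial (α : ℝ) (k : ℕ) : ℝ := ∏ j ∈ Finset.range k, (α + j)

/-- The binomial series `∑ (α)_k (ε t)^k / k!`, which represents `(1 - ε t)^(-α)`. -/
noncomputable def risingFactorialSeries (α ε : ℝ) : PowerSeries ℝ :=
  PowerSeries.mk fun k => ε ^ k * risingFactorial α k / (k.factorial : ℝ)

lemma risingFactorial_zero (α : ℝ) : risingFactorial α 0 = 1 := by
  simp [risingFactorial]

lemma risingFactorial_succ (α : ℝ) (k : ℕ) :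
    risingFactorial α (k + 1) = risingFactorial α k * (α + k) := by
  simp [risingFactorial, Finset.prod_range_succ]

lemma risingFactorial_add (α : ℝ) (n k : ℕ) :
    risingFactorial α (n + k) = risingFactorial α n * risingFactorial (α + n) k := by
  simp [risingFactorial, Finset.prod_range_add, add_assoc]

lemma coeff_risingFactorialSeries_succ (α ε : ℝ) (k : ℕ) :
    PowerSeries.coeff (k + 1) (risingFactorialSeries α ε) * (k + 1) =
      ε * (α + k) * PowerSeries.coeff k (risingFactorialSeries α ε) := by
  have hk : (k.factorial : ℝ) ≠ 0 := by positivity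
  have hk' : (k : ℝ) + 1 ≠ 0 := by positivity
  simp only [risingFactorialSeries, PowerSeries.coeff_mk, risingFactorial_succ,
    Nat.factorial_succ, pow_succ]
  push_cast
  field_simp

lemma coeff_X_mul_derivative (f : PowerSeries ℝ) (k : ℕ) :
    PowerSeries.coeff k (PowerSeries.X * PowerSeries.derivative ℝ f) =
      k * PowerSeries.coeff k f := by
  cases k with
  | zero => simp
  | succ k =>
    rw [PowerSeries.coeff_succ_X_mul, PowerSeries.coeff_derivative]
    push_cast
    ring

/-- The differential equation `(1 - ε t) f' = ε α f` of the binomial series. -/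
lemma derivative_risingFactorialSeries (α ε : ℝ) :
    (1 - PowerSeries.C ε * PowerSeries.X) *
        PowerSeries.derivative ℝ (risingFactorialSeries α ε) =
      PowerSeries.C (ε * α) * risingFactorialSeries α ε := by
  ext k
  rw [sub_mul, one_mul, mul_assoc, map_sub, PowerSeries.coeff_C_mul, PowerSeries.coeff_C_mul,
    PowerSeries.coeff_derivative, coeff_risingFactorialSeries_succ]
  rw [coeff_X_mul_derivative]
  ring

/-- The differential equation `(1 - t²) h' = 2 α t h` of `h = (1 + t)^(-α) (1 - t)^(-α)`. -/
lemma derivative_risingFactorialSeries_mul (α : ℝ) :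
    (1 - PowerSeries.X ^ 2) * PowerSeries.derivative ℝ
        (risingFactorialSeries α (-1) * risingFactorialSeries α 1) =
      PowerSeries.C (2 * α) * (PowerSeries.X *
        (risingFactorialSeries α (-1) * risingFactorialSeries α 1)) := by
  have h₁ := derivative_risingFactorialSeries α 1
  have h₂ := derivative_risingFactorialSeries α (-1)
  simp only [map_neg, map_one, map_mul, one_mul, neg_mul, map_ofNat] at h₁ h₂ ⊢
  rw [Derivation.leibniz, smul_eq_mul, smul_eq_mul]
  linear_combination (1 + PowerSeries.X) * risingFactorialSeries α (-1) * h₁ +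
    (1 - PowerSeries.X) * risingFactorialSeries α 1 * h₂

lemma coeff_risingFactorialSeries_mul (α : ℝ) (r : ℕ) :
    ((2 * r).factorial : ℝ) * PowerSeries.coeff (2 * r)
        (risingFactorialSeries α (-1) * risingFactorialSeries α 1) =
      2 ^ (2 * r) * risingFactorial (1 / 2) r * risingFactorial α r := by
  induction r with
  | zero => simp [risingFactorialSeries, risingFactorial_zero]
  | succ r ih =>
    have h := congrArg (PowerSeries.coeff (2 * r + 1)) (derivative_risingFactorialSeries_mul α)
    rw [sub_mul, one_mul, map_sub, PowerSeries.coeff_C_mul, PowerSeries.coeff_succ_X_mul,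
      pow_two, mul_assoc PowerSeries.X, PowerSeries.coeff_succ_X_mul,
      PowerSeries.coeff_derivative, coeff_X_mul_derivative] at h
    rw [show 2 * (r + 1) = 2 * r + 1 + 1 by ring, Nat.factorial_succ, Nat.factorial_succ,
      risingFactorial_succ, risingFactorial_succ]
    push_cast at h ⊢
    linear_combination (2 * r + 1) * ((2 * r).factorial : ℝ) * h +
      (2 * r + 1) * (2 * α + 2 * r) * ih

lemma sum_choose_mul_risingFactorial (α : ℝ) (m : ℕ) :
    ∑ i ∈ Finset.range (m + 1), (-1 : ℝ) ^ i * (Nat.choose m i : ℝ) *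
        risingFactorial α (m - i) * risingFactorial α i =
      (m.factorial : ℝ) * PowerSeries.coeff m
        (risingFactorialSeries α (-1) * risingFactorialSeries α 1) := by
  rw [PowerSeries.coeff_mul, Finset.Nat.sum_antidiagonal_eq_sum_range_succ_mk, Finset.mul_sum]
  refine Finset.sum_congr rfl fun i hi => ?_
  have him : i ≤ m := Nat.lt_succ_iff.mp (Finset.mem_range.mp hi)
  simp only [risingFactorialSeries, PowerSeries.coeff_mk, one_pow, one_mul]
  rw [Nat.cast_choose ℝ him]
  field_simp

/-- For every positive integer `r` and nonnegative integer `n`: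
`∑_{i=0}^{2r} (-1)^i C(2r, i) (1/2)_{n+2r-i} (1/2)_{n+i}
  = 2^{2r} (1/2)_n (1/2)_r (1/2)_{n+r}`. -/
theorem alternating_sum_rising_factorial_identity (r : ℕ) (hr : 0 < r) (n : ℕ) :
    ∑ i ∈ Finset.range (2 * r + 1),
        (-1 : ℝ) ^ i * (Nat.choose (2 * r) i : ℝ) *
          risingFactorial (1 / 2) (n + 2 * r - i) * risingFactorial (1 / 2) (n + i)
      = 2 ^ (2 * r) * risingFactorial (1 / 2) n * risingFactorial (1 / 2) r *
          risingFactorial (1 / 2) (n + r) := by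
  have h := sum_choose_mul_risingFactorial (1 / 2 + n) (2 * r)
  rw [coeff_risingFactorialSeries_mul] at h
  rw [risingFactorial_add _ n r]
  calc _ = risingFactorial (1 / 2) n ^ 2 * ∑ i ∈ Finset.range (2 * r + 1),
        (-1 : ℝ) ^ i * (Nat.choose (2 * r) i : ℝ) *
          risingFactorial (1 / 2 + n) (2 * r - i) * risingFactorial (1 / 2 + n) i := by
        rw [Finset.mul_sum]
        refine Finset.sum_congr rfl fun i hi => ?_
        have hir : i ≤ 2 * r := Nat.lt_succ_iff.mp (Finset.mem_range.mp hi)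
        rw [Nat.add_sub_assoc hir, risingFactorial_add, risingFactorial_add]
        ring
    _ = _ := by rw [h]; ring
end

section
/- Let l and r be positive integers with l ≤ r. Then ∑_{i=0}^{l−1} C(2r, i) · C(l−1, i) / C(2r−l, i) = (2r)! / (2 · r! · r! · C(2r−l, r)), where C(a, b) denotes the ordinary binomial coefficient and the sum is over real-valued quotients of binomial coefficients. -/
open PowerSeries in
/-- Extracting the coefficient of `X ^ n` in `(1 + X) ^ (2 * a + 2 * n) / (1 - X) ^ (2 * a)`. -/
theorem PowerSeries.coeff_one_add_X_pow_mul_invOneSubPow (a n : ℕ) :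
    coeff n ((1 + X : ℝ⟦X⟧) ^ (2 * a + 2 * n) * (invOneSubPow ℝ (2 * a)).val) =
      ((2 * a + 2 * n).factorial * a.factorial : ℝ) /
        ((a + n).factorial * n.factorial * (2 * a).factorial) := by
  induction a generalizing n with
  | zero =>
    have h : (1 + X : ℝ⟦X⟧) ^ (2 * n) =
        (((1 + Polynomial.X) ^ (2 * n) : Polynomial ℝ) : ℝ⟦X⟧) := by simp
    simp only [mul_zero, zero_add, invOneSubPow_zero, Units.val_one, mul_one, h,
      Polynomial.coeff_coe, Polynomial.coeff_one_add_X_pow]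
    rw [Nat.cast_choose ℝ (by omega), show 2 * n - n = n by omega]
    simp
  | succ a iha =>
    induction n with
    | zero =>
      have h : constantCoeff (invOneSubPow ℝ (2 * (a + 1))).val = 1 := by
        rw [show 2 * (a + 1) = 2 * a + 1 + 1 by ring, invOneSubPow_val_succ_eq_mk_add_choose,
          ← coeff_zero_eq_constantCoeff_apply]
        simp
      simp only [coeff_zero_eq_constantCoeff, map_mul, map_pow, h]
      simp only [map_add, map_one, constantCoeff_X]
      have h1 := Nat.factorial_ne_zero (2 * (a + 1))
      have h2 := Nat.factorial_ne_zero (a + 1)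
      field_simp
      simp
    | succ n ihn =>
      have hinv : (invOneSubPow ℝ (2 * a)).val =
          (invOneSubPow ℝ (2 * (a + 1))).val * (1 - X) ^ 2 := by
        rw [show 2 * (a + 1) = 2 * a + 2 by ring, invOneSubPow_add, Units.val_mul, mul_assoc,
          ← invOneSubPow_inv_eq_one_sub_pow, Units.val_inv, mul_one]
      have hrec : (1 + X : ℝ⟦X⟧) ^ (2 * (a + 1) + 2 * (n + 1)) *
            (invOneSubPow ℝ (2 * (a + 1))).val =
          (1 + X) ^ (2 * a + 2 * (n + 1)) * (invOneSubPow ℝ (2 * a)).val +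
          C (4 : ℝ) * (X * ((1 + X) ^ (2 * (a + 1) + 2 * n) *
            (invOneSubPow ℝ (2 * (a + 1))).val)) := by
        rw [hinv, show C (4 : ℝ) = (4 : ℝ⟦X⟧) from map_ofNat _ 4]
        ring
      rw [hrec, map_add, coeff_C_mul, coeff_succ_X_mul, ihn, iha]
      rw [show 2 * (a + 1) + 2 * (n + 1) = 2 * a + 2 * n + 1 + 1 + 1 + 1 by ring,
        show 2 * (a + 1) + 2 * n = 2 * a + 2 * n + 1 + 1 by ring,
        show 2 * a + 2 * (n + 1) = 2 * a + 2 * n + 1 + 1 by ring,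
        show a + 1 + (n + 1) = a + n + 1 + 1 by ring,
        show a + (n + 1) = a + n + 1 by ring, show a + 1 + n = a + n + 1 by ring,
        show 2 * (a + 1) = 2 * a + 1 + 1 by ring]
      simp only [Nat.factorial_succ]
      have h1 := Nat.factorial_ne_zero (2 * a)
      have h2 := Nat.factorial_ne_zero a
      have h3 := Nat.factorial_ne_zero n
      have h4 := Nat.factorial_ne_zero (a + n)
      push_cast
      field_simp
      ring

open PowerSeries in
theorem sum_choose_mul_choose_eq_factorial_div (b n : ℕ) :
    ∑ i ∈ Finset.range (n + 1),
        ((2 * (b + 1) + 2 * n).choose i : ℝ) * ((2 * b + 1 + (n - i)).choose (2 * b + 1) : ℝ) =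
      ((2 * (b + 1) + 2 * n).factorial * (b + 1).factorial : ℝ) /
        ((b + 1 + n).factorial * n.factorial * (2 * (b + 1)).factorial) := by
  rw [← coeff_one_add_X_pow_mul_invOneSubPow, coeff_mul,
    Finset.Nat.sum_antidiagonal_eq_sum_range_succ_mk]
  refine Finset.sum_congr rfl fun i _ => ?_
  have h : (1 + X : ℝ⟦X⟧) ^ (2 * (b + 1) + 2 * n) =
      (((1 + Polynomial.X) ^ (2 * (b + 1) + 2 * n) : Polynomial ℝ) : ℝ⟦X⟧) := by simp
  rw [h, Polynomial.coeff_coe, Polynomial.coeff_one_add_X_pow,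
    show invOneSubPow ℝ (2 * (b + 1)) = invOneSubPow ℝ (2 * b + 1 + 1) from rfl,
    invOneSubPow_val_succ_eq_mk_add_choose, coeff_mk]

theorem choose_div_choose_add (m n i : ℕ) (hi : i ≤ n) :
    (n.choose i : ℝ) / ((m + n).choose i : ℝ) =
      ((m + (n - i)).choose m : ℝ) / ((m + n).choose m : ℝ) := by
  obtain ⟨k, rfl⟩ := Nat.exists_eq_add_of_le hi
  rw [Nat.add_sub_cancel_left, show m + (i + k) = i + (m + k) by ring, Nat.cast_add_choose,
    Nat.cast_add_choose, Nat.cast_add_choose, show i + (m + k) = m + (i + k) by ring,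
    Nat.cast_add_choose]
  have h1 := Nat.factorial_ne_zero i
  have h2 := Nat.factorial_ne_zero k
  have h3 := Nat.factorial_ne_zero m
  have h4 := Nat.factorial_ne_zero (i + k)
  have h5 := Nat.factorial_ne_zero (m + k)
  have h6 := Nat.factorial_ne_zero (m + (i + k))
  field_simp

/-- For positive integers `l ≤ r`:
`∑_{i=0}^{l-1} C(2r, i) C(l-1, i) / C(2r-l, i) = (2r)! / (2 r! r! C(2r-l, r))`. -/
theorem kummer_type_binomial_sum (l r : ℕ) (hl : 0 < l) (hr : 0 < r) (hlr : l ≤ r) :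
    ∑ i ∈ Finset.range l,
        (Nat.choose (2 * r) i : ℝ) * (Nat.choose (l - 1) i : ℝ) /
          (Nat.choose (2 * r - l) i : ℝ)
      = (Nat.factorial (2 * r) : ℝ) /
          (2 * (Nat.factorial r : ℝ) * (Nat.factorial r : ℝ) *
            (Nat.choose (2 * r - l) r : ℝ)) := by
  obtain ⟨n, rfl⟩ := Nat.exists_eq_add_of_lt hl
  obtain ⟨b, rfl⟩ := Nat.exists_eq_add_of_le hlr
  simp only [zero_add, Nat.add_sub_cancel]
  rw [show 2 * (n + 1 + b) - (n + 1) = 2 * b + 1 + n by omega,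
    show 2 * (n + 1 + b) = 2 * (b + 1) + 2 * n by ring, show n + 1 + b = b + 1 + n by ring]
  have hterm : ∀ i ∈ Finset.range (n + 1),
      ((2 * (b + 1) + 2 * n).choose i : ℝ) * (n.choose i : ℝ) / ((2 * b + 1 + n).choose i : ℝ) =
        ((2 * (b + 1) + 2 * n).choose i : ℝ) * ((2 * b + 1 + (n - i)).choose (2 * b + 1) : ℝ) /
          ((2 * b + 1 + n).choose (2 * b + 1) : ℝ) := fun i hi => by
    rw [mul_div_assoc, choose_div_choose_add _ _ _ (Finset.mem_range_succ_iff.mp hi),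
      mul_div_assoc]
  rw [Finset.sum_congr rfl hterm, ← Finset.sum_div, sum_choose_mul_choose_eq_factorial_div,
    Nat.cast_add_choose, show 2 * b + 1 + n = b + 1 + n + b by ring, Nat.cast_add_choose,
    show 2 * (b + 1) = 2 * b + 1 + 1 by ring, Nat.factorial_succ (2 * b + 1),
    Nat.factorial_succ b]
  have h1 := Nat.factorial_ne_zero n
  have h2 := Nat.factorial_ne_zero b
  have h3 := Nat.factorial_ne_zero (2 * b + 1)
  have h4 := Nat.factorial_ne_zero (b + 1 + n)
  have h5 := Nat.factorial_ne_zero (b + 1 + n + b)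
  push_cast
  field_simp
  ring
end

section
/- Let l and r be positive integers with l ≤ r. Then (2 · r! · (l−1)! · (2r−2l+1)! / ((2r)! · (r−l)!)) · ∑_{i=0}^{l−1} C(2r, i) · C(2r−l−i, 2r−2l+1) = 1, where C(a, b) denotes the ordinary binomial coefficient. -/
open PowerSeries in
theorem PowerSeries.coeff_one_add_X_pow (R : Type*) [CommSemiring R] (N i : ℕ) :
    coeff i ((1 + X : R⟦X⟧) ^ N) = (N.choose i : R) := by
  rw [← Polynomial.coeff_one_add_X_pow, ← Polynomial.coeff_coe]
  simp

open PowerSeries in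
/-- Since `(1 + X)² - 4X = (1 - X)²`, the coefficients of `(1 + X)^(2n+2k) / (1 - X)^(2k)` satisfy
a Pascal-type recurrence in `n` and `k`. -/
theorem coeff_one_add_X_pow_mul_mk_one_pow_succ_succ (R : Type*) [CommRing R] (n k : ℕ) :
    coeff (n + 1) ((1 + X : R⟦X⟧) ^ (2 * (n + 1) + 2 * (k + 1)) * mk 1 ^ (2 * (k + 1))) =
      4 * coeff n ((1 + X : R⟦X⟧) ^ (2 * n + 2 * (k + 1)) * mk 1 ^ (2 * (k + 1))) +
        coeff (n + 1) ((1 + X : R⟦X⟧) ^ (2 * (n + 1) + 2 * k) * mk 1 ^ (2 * k)) := by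
  have hG : (mk 1 : R⟦X⟧) ^ 2 * (1 - X) ^ 2 = 1 := by
    rw [← mul_pow, mk_one_mul_one_sub_eq_one, one_pow]
  have key : (1 + X : R⟦X⟧) ^ (2 * (n + 1) + 2 * (k + 1)) * mk 1 ^ (2 * (k + 1)) =
      X * (C 4 * ((1 + X : R⟦X⟧) ^ (2 * n + 2 * (k + 1)) * mk 1 ^ (2 * (k + 1)))) +
        (1 + X : R⟦X⟧) ^ (2 * (n + 1) + 2 * k) * mk 1 ^ (2 * k) := by
    have h4 : (C 4 : R⟦X⟧) = 4 := map_ofNat C 4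
    rw [h4]
    generalize (mk 1 : R⟦X⟧) = G at hG ⊢
    linear_combination (1 + X : R⟦X⟧) ^ (2 * (n + 1) + 2 * k) * G ^ (2 * k) * hG
  rw [key, map_add, coeff_succ_X_mul, coeff_C_mul]

open PowerSeries Nat in
theorem coeff_one_add_X_pow_mul_mk_one_pow (n k : ℕ) :
    coeff n ((1 + X : ℝ⟦X⟧) ^ (2 * n + 2 * k) * mk 1 ^ (2 * k)) =
      ((2 * n + 2 * k)! * k ! : ℝ) / ((n + k)! * n ! * (2 * k)!) := by
  induction k generalizing n with
  | zero =>
    rw [mul_zero, pow_zero, mul_one, PowerSeries.coeff_one_add_X_pow,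
      Nat.cast_choose ℝ (by lia : n ≤ 2 * n + 0), show 2 * n + 0 - n = n by lia]
    simp
  | succ k ihk =>
    induction n with
    | zero =>
      simp
      field_simp
    | succ n ihn =>
      rw [coeff_one_add_X_pow_mul_mk_one_pow_succ_succ, ihn, ihk,
        show 2 * (n + 1) + 2 * (k + 1) = 2 * n + 2 * k + 1 + 1 + 1 + 1 by ring,
        show 2 * n + 2 * (k + 1) = 2 * n + 2 * k + 1 + 1 by ring,
        show 2 * (n + 1) + 2 * k = 2 * n + 2 * k + 1 + 1 by ring,
        show 2 * (k + 1) = 2 * k + 1 + 1 by ring,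
        show n + 1 + (k + 1) = n + k + 1 + 1 by ring,
        show n + (k + 1) = n + k + 1 by ring, show n + 1 + k = n + k + 1 by ring]
      simp only [Nat.factorial_succ]
      push_cast
      field_simp
      ring

open PowerSeries in
theorem sum_range_choose_mul_choose (N n d : ℕ) :
    ∑ i ∈ Finset.range (n + 1), (N.choose i : ℝ) * ((d + (n - i)).choose d : ℝ) =
      coeff n ((1 + X : ℝ⟦X⟧) ^ N * mk 1 ^ (d + 1)) := by
  rw [mk_one_pow_eq_mk_choose_add, coeff_mul,
    Finset.Nat.sum_antidiagonal_eq_sum_range_succ_mk]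
  simp [PowerSeries.coeff_one_add_X_pow]

/-- For positive integers `l ≤ r`:
`(2 r! (l-1)! (2r-2l+1)! / ((2r)! (r-l)!)) ∑_{i=0}^{l-1} C(2r, i) C(2r-l-i, 2r-2l+1) = 1`. -/
theorem binomial_sum_normalization (l r : ℕ) (hl : 0 < l) (hr : 0 < r) (hlr : l ≤ r) :
    (2 * (Nat.factorial r : ℝ) * (Nat.factorial (l - 1) : ℝ) *
        (Nat.factorial (2 * r - 2 * l + 1) : ℝ)) /
        ((Nat.factorial (2 * r) : ℝ) * (Nat.factorial (r - l) : ℝ)) *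
      ∑ i ∈ Finset.range l,
        (Nat.choose (2 * r) i : ℝ) * (Nat.choose (2 * r - l - i) (2 * r - 2 * l + 1) : ℝ)
      = 1 := by
  obtain ⟨n, rfl⟩ := Nat.exists_eq_add_of_lt hl
  obtain ⟨m, rfl⟩ := Nat.exists_eq_add_of_le hlr
  have hsum : ∑ i ∈ Finset.range (0 + n + 1), (Nat.choose (2 * (0 + n + 1 + m)) i : ℝ) *
      (Nat.choose (2 * (0 + n + 1 + m) - (0 + n + 1) - i)
        (2 * (0 + n + 1 + m) - 2 * (0 + n + 1) + 1) : ℝ) =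
      PowerSeries.coeff n ((1 + PowerSeries.X : PowerSeries ℝ) ^ (2 * n + 2 * (m + 1)) *
        PowerSeries.mk 1 ^ (2 * (m + 1))) := by
    rw [show 2 * (m + 1) = 2 * m + 1 + 1 by ring, ← sum_range_choose_mul_choose, zero_add]
    refine Finset.sum_congr rfl fun i hi => ?_
    have hi : i ≤ n := Nat.lt_succ_iff.mp (Finset.mem_range.mp hi)
    congr 3 <;> lia
  rw [hsum, coeff_one_add_X_pow_mul_mk_one_pow,
    show 2 * (0 + n + 1 + m) - 2 * (0 + n + 1) + 1 = 2 * m + 1 by lia,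
    show 0 + n + 1 + m - (0 + n + 1) = m by lia, show 0 + n + 1 - 1 = n by lia,
    show 2 * (0 + n + 1 + m) = 2 * n + 2 * (m + 1) by ring,
    show 0 + n + 1 + m = n + (m + 1) by ring, show 2 * (m + 1) = 2 * m + 1 + 1 by ring,
    Nat.factorial_succ m, Nat.factorial_succ (2 * m + 1)]
  push_cast
  field_simp
  ring
end

section
/- Let l and r be positive integers with l ≤ r. Then ∑_{i=0}^{l−1} C(l−1, i) / C(2r−i, l) = 1 / (2 · C(r, l)), where C(a, b) denotes the ordinary binomial coefficient and the equation is between real numbers. -/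
theorem integral_pow_mul_one_sub_pow_eq_factorial (k m : ℕ) :
    ∫ u in (0 : ℝ)..1, u ^ k * (1 - u) ^ m =
      (k.factorial * m.factorial : ℝ) / (k + m + 1).factorial := by
  induction m generalizing k with
  | zero =>
    have hk : (k.factorial : ℝ) ≠ 0 := by exact_mod_cast k.factorial_ne_zero
    have hk' : (k + 1 : ℝ) ≠ 0 := by positivity
    simp only [pow_zero, mul_one, integral_pow, add_zero, Nat.factorial_succ, Nat.factorial_zero]
    push_cast
    field_simp
    simp
  | succ m ih =>
    have split : ∀ u : ℝ, u ^ k * (1 - u) ^ (m + 1) =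
        u ^ k * (1 - u) ^ m - u ^ (k + 1) * (1 - u) ^ m := fun u => by ring
    simp only [split]
    rw [intervalIntegral.integral_sub
      (Continuous.intervalIntegrable (by fun_prop) _ _)
      (Continuous.intervalIntegrable (by fun_prop) _ _), ih, ih,
      show k + 1 + m + 1 = (k + m + 1) + 1 by ring,
      show k + (m + 1) + 1 = (k + m + 1) + 1 by ring]
    have hkm : ((k + m + 1).factorial : ℝ) ≠ 0 := by
      exact_mod_cast (k + m + 1).factorial_ne_zero
    have hkm' : (k + m + 1 + 1 : ℝ) ≠ 0 := by positivity
    rw [Nat.factorial_succ (k + m + 1), Nat.factorial_succ k, Nat.factorial_succ m]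
    push_cast
    field_simp
    ring

theorem one_div_choose_eq_integral (k m : ℕ) :
    1 / ((k + (m + 1)).choose (m + 1) : ℝ) =
      (m + 1) * ∫ u in (0 : ℝ)..1, u ^ k * (1 - u) ^ m := by
  rw [integral_pow_mul_one_sub_pow_eq_factorial, ← Nat.choose_symm_add, Nat.cast_add_choose,
    Nat.factorial_succ m, one_div_div, ← add_assoc]
  push_cast
  ring

theorem integral_sq_substitution (s m : ℕ) :
    ∫ u in (0 : ℝ)..1, u ^ (2 * s + 1) * (1 - u ^ 2) ^ m =
      (∫ v in (0 : ℝ)..1, v ^ s * (1 - v) ^ m) / 2 := by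
  have h := intervalIntegral.integral_comp_mul_deriv (a := 0) (b := 1)
    (f := fun u : ℝ => u ^ 2) (f' := fun u => 2 * u) (g := fun v : ℝ => v ^ s * (1 - v) ^ m)
    (fun u _ => by simpa using hasDerivAt_pow 2 u) (by fun_prop) (by fun_prop)
  norm_num at h
  rw [← h, ← intervalIntegral.integral_div]
  congr 1
  ext u
  ring

/-- For positive integers `l ≤ r`:
`∑_{i=0}^{l-1} C(l-1, i) / C(2r-i, l) = 1 / (2 C(r, l))`. -/
theorem binomial_reciprocal_sum (l r : ℕ) (hl : 0 < l) (hr : 0 < r) (hlr : l ≤ r) :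
    ∑ i ∈ Finset.range l,
        (Nat.choose (l - 1) i : ℝ) / (Nat.choose (2 * r - i) l : ℝ)
      = 1 / (2 * (Nat.choose r l : ℝ)) := by
  obtain ⟨m, rfl⟩ : ∃ m, l = m + 1 := ⟨l - 1, by omega⟩
  obtain ⟨s, rfl⟩ : ∃ s, r = s + (m + 1) := ⟨r - (m + 1), by omega⟩
  have term : ∀ i ∈ Finset.range (m + 1),
      ((m + 1 - 1).choose i : ℝ) / ((2 * (s + (m + 1)) - i).choose (m + 1) : ℝ) =
        (m + 1) * ∫ u in (0 : ℝ)..1,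
          (m.choose i : ℝ) * (u ^ (2 * s + 1 + (m - i)) * (1 - u) ^ m) := by
    intro i hi
    rw [Finset.mem_range] at hi
    rw [show 2 * (s + (m + 1)) - i = 2 * s + 1 + (m - i) + (m + 1) by omega,
      Nat.add_sub_cancel, div_eq_mul_one_div, one_div_choose_eq_integral,
      intervalIntegral.integral_const_mul]
    ring
  have binom : ∀ u : ℝ, ∑ i ∈ Finset.range (m + 1),
      (m.choose i : ℝ) * (u ^ (2 * s + 1 + (m - i)) * (1 - u) ^ m) =
        u ^ (2 * s + 1) * (1 - u ^ 2) ^ m := by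
    intro u
    rw [show 1 - u ^ 2 = (1 + u) * (1 - u) by ring, mul_pow, add_pow, Finset.sum_mul,
      Finset.mul_sum]
    refine Finset.sum_congr rfl fun i _ => ?_
    rw [one_pow, pow_add]
    ring
  rw [Finset.sum_congr rfl term, ← Finset.mul_sum, ← intervalIntegral.integral_finsetSum
    (fun i _ => Continuous.intervalIntegrable (by fun_prop) _ _)]
  simp only [binom]
  rw [integral_sq_substitution, ← mul_div_assoc, ← one_div_choose_eq_integral, div_div, mul_comm 2]
end

section
/- Let m, n, r be positive integers and let 0 ≤ i ≤ r. Then binom½(m + r − i, r − i) · binom½(n + i, i) ≥ binom½((m ∧ n) + r, r), where m ∧ n denotes min(m, n). -/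
/-- `oddDoubleFactorial n = (2n - 1)!! = 1 * 3 * ⋯ * (2n - 1)`, with `(-1)!! = 1`. -/
def oddDoubleFactorial (n : ℕ) : ℕ := ∏ k ∈ Finset.range n, (2 * k + 1)

/-- The half-binomial coefficient `binom½(n, k) = (2n-1)!! / ((2n-2k-1)!! (2k-1)!!)`. -/
noncomputable def halfBinom (n k : ℕ) : ℝ :=
  (oddDoubleFactorial n : ℝ) /
    ((oddDoubleFactorial (n - k) : ℝ) * (oddDoubleFactorial k : ℝ))

theorem oddDoubleFactorial_pos (n : ℕ) : 0 < oddDoubleFactorial n :=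
  Finset.prod_pos fun _ _ => Nat.succ_pos _

theorem oddDoubleFactorial_succ (n : ℕ) :
    oddDoubleFactorial (n + 1) = oddDoubleFactorial n * (2 * n + 1) :=
  Finset.prod_range_succ _ _

theorem halfBinom_nonneg (n k : ℕ) : 0 ≤ halfBinom n k := by
  unfold halfBinom
  positivity

theorem halfBinom_zero_right (n : ℕ) : halfBinom n 0 = 1 := by
  have h : (oddDoubleFactorial n : ℝ) ≠ 0 := mod_cast (oddDoubleFactorial_pos n).ne'
  have h₀ : oddDoubleFactorial 0 = 1 := Finset.prod_range_zero _
  simp [halfBinom, h₀, h]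

theorem halfBinom_add_succ (m k : ℕ) :
    halfBinom (m + (k + 1)) (k + 1) =
      halfBinom (m + k) k * ((2 * m + 2 * k + 1) / (2 * k + 1)) := by
  have hm : (oddDoubleFactorial m : ℝ) ≠ 0 := mod_cast (oddDoubleFactorial_pos m).ne'
  have hk : (oddDoubleFactorial k : ℝ) ≠ 0 := mod_cast (oddDoubleFactorial_pos k).ne'
  have hk' : (2 * k + 1 : ℝ) ≠ 0 := by positivity
  unfold halfBinom
  rw [Nat.add_sub_cancel, Nat.add_sub_cancel, ← add_assoc, oddDoubleFactorial_succ,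
    oddDoubleFactorial_succ]
  push_cast
  field_simp

theorem halfBinom_add_le_of_le {a b : ℕ} (h : a ≤ b) (k : ℕ) :
    halfBinom (a + k) k ≤ halfBinom (b + k) k := by
  induction k with
  | zero => simp [halfBinom_zero_right]
  | succ k ih =>
    rw [halfBinom_add_succ, halfBinom_add_succ]
    refine mul_le_mul ih ?_ (by positivity) (halfBinom_nonneg _ _)
    gcongr

/-- `k ↦ binom½(a + k, k)` is submultiplicative. -/
theorem halfBinom_add_le_mul (a p q : ℕ) :
    halfBinom (a + (p + q)) (p + q) ≤ halfBinom (a + p) p * halfBinom (a + q) q := by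
  induction q with
  | zero => simp [halfBinom_zero_right]
  | succ q ih =>
    rw [← add_assoc p, halfBinom_add_succ, halfBinom_add_succ, ← mul_assoc]
    refine mul_le_mul ih ?_ (by positivity)
      (mul_nonneg (halfBinom_nonneg _ _) (halfBinom_nonneg _ _))
    push_cast
    rw [div_le_div_iff₀ (by positivity) (by positivity)]
    have hap : (0 : ℝ) ≤ a * p := by positivity
    nlinarith

/-- For positive integers `m, n, r` and `0 ≤ i ≤ r`:
`binom½(m+r-i, r-i) binom½(n+i, i) ≥ binom½(min m n + r, r)`. -/
theorem halfBinom_product_lower_bound (m n r : ℕ) (hm : 0 < m) (hn : 0 < n)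
    (hr : 0 < r) (i : ℕ) (hi : i ≤ r) :
    halfBinom (m + r - i) (r - i) * halfBinom (n + i) i
      ≥ halfBinom (min m n + r) r := by
  have hmr : m + r - i = m + (r - i) := by omega
  rw [hmr, ge_iff_le]
  calc halfBinom (min m n + r) r = halfBinom (min m n + ((r - i) + i)) ((r - i) + i) := by
        rw [Nat.sub_add_cancel hi]
    _ ≤ halfBinom (min m n + (r - i)) (r - i) * halfBinom (min m n + i) i :=
        halfBinom_add_le_mul _ _ _
    _ ≤ halfBinom (m + (r - i)) (r - i) * halfBinom (n + i) i :=
        mul_le_mul (halfBinom_add_le_of_le (min_le_left m n) _)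
          (halfBinom_add_le_of_le (min_le_right m n) _)
          (halfBinom_nonneg _ _) (halfBinom_nonneg _ _)
end
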